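/- arXiv:math/0404396 — 2 statements merged into one kernel-verified Lean document; each statement's English description precedes it below -/
import Mathlib

section
/- A finite poset belongs to N₂ if and only if each of its connected components P reduces to a poset P̃ that is isomorphic to a convex subposet of a cylinder poset Cyl_{k,n} for some positive integers k < n, subject to the following condition: for every four-element diamond {w ⋖ x ⋖ z, w ⋖ y ⋖ z} in P̃ that does not go around the cylinder, max{s(w), s(z)} ≤ min{s(x), s(y)}, where s(v) denotes the number of elements of the chain of P into which the element v of P̃ splits. -/
/-- A saturated chain in a poset: a chain such that any two consecutive elements of the
chain form a covering relation of the ambient poset. -/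
def IsSatChain (P : Type*) [PartialOrder P] (c : Set P) : Prop :=
  IsChain (· ≤ ·) c ∧
    ∀ x ∈ c, ∀ y ∈ c, x < y → (∀ z ∈ c, ¬(x < z ∧ z < y)) → x ⋖ y

/-- A chain cover of a poset: a set of pairwise disjoint saturated chains whose
union is the whole poset. -/
def IsChainCover (P : Type*) [PartialOrder P] (C : Set (Set P)) : Prop :=
  (∀ c ∈ C, IsSatChain P c) ∧ C.PairwiseDisjoint id ∧ ∀ x : P, ∃ c ∈ C, x ∈ c

/-- `mu` is the `C`-sort of the labeling `lam`: on each chain of `C`, `mu` rearranges the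
multiset of `lam`-labels of that chain so that they are weakly increasing along the chain. -/
def IsCSort (P : Type*) [PartialOrder P] (C : Set (Set P)) (lam mu : P → ℝ) : Prop :=
  ∃ σ : Equiv.Perm P, (∀ c ∈ C, ∀ x ∈ c, σ x ∈ c) ∧ (∀ x, mu x = lam (σ x)) ∧
    ∀ c ∈ C, ∀ x ∈ c, ∀ y ∈ c, x ≤ y → mu x ≤ mu y

/-- The labeling `nu` is weakly increasing along every chain of `C`. -/
def SortedAlong (P : Type*) [PartialOrder P] (C : Set (Set P)) (nu : P → ℝ) : Prop :=
  ∀ c ∈ C, ∀ x ∈ c, ∀ y ∈ c, x ≤ y → nu x ≤ nu y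

/-- `P` has the non-messing-up property via the (unordered) pair of chain covers
`{C₁, C₂}`: for any labeling, sorting along one cover and then along the other leaves the
labels sorted along the chains of the first cover, and moreover every covering relation of
`P` lies in some chain of `C₁` or of `C₂`. -/
def NMUvia (P : Type*) [PartialOrder P] (C₁ C₂ : Set (Set P)) : Prop :=
  IsChainCover P C₁ ∧ IsChainCover P C₂ ∧
  (∀ lam mu nu : P → ℝ, IsCSort P C₁ lam mu → IsCSort P C₂ mu nu → SortedAlong P C₁ nu) ∧
  (∀ lam mu nu : P → ℝ, IsCSort P C₂ lam mu → IsCSort P C₁ mu nu → SortedAlong P C₂ nu) ∧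
  ∀ x y : P, x ⋖ y → ∃ c, (c ∈ C₁ ∨ c ∈ C₂) ∧ x ∈ c ∧ y ∈ c

/-- The class `N₂`: posets having the non-messing-up property via some pair of chain
covers. -/
def InN2 (P : Type*) [PartialOrder P] : Prop := ∃ C₁ C₂, NMUvia P C₁ C₂

/-- The connected component of `x` in the comparability graph of the poset `P`. -/
def ConnComp (P : Type*) [PartialOrder P] (x : P) : Set P :=
  {y | Relation.ReflTransGen (fun a b : P => a ≤ b ∨ b ≤ a) x y}

/-- One step of the equivalence `(i, j) ∼ (i − k, j + (n − k))` defining the cylinder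
poset `Cyl_{k,n}`, iterated `t` times: `q` is the translate of `p` by `t • (−k, n−k)`. -/
def CylRel (k n : ℕ) (p q : ℤ × ℤ) : Prop :=
  ∃ t : ℤ, q.1 = p.1 - t * k ∧ q.2 = p.2 + t * ((n : ℤ) - k)

/-- The order relation of the cylinder poset `Cyl_{k,n}`, expressed on representatives in
`ℤ²`: the class of `p` is below the class of `q` iff some representatives are
componentwise comparable. -/
def CylLe (k n : ℕ) (p q : ℤ × ℤ) : Prop :=
  ∃ p' q' : ℤ × ℤ, CylRel k n p p' ∧ CylRel k n q q' ∧ p'.1 ≤ q'.1 ∧ p'.2 ≤ q'.2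


/-- `h` exhibits the poset `P` as a poset that reduces (by splitting elements) to a convex
subposet of the cylinder poset `Cyl_{k,n}`: each element of `P` is assigned a representative
in `ℤ²`, the fiber over each cylinder point is a chain of `P` (the chain into which that
element splits), comparabilities between distinct fibers are exactly those of the cylinder
order, and the image is convex in the cylinder. -/
def IsCylReduction (k n : ℕ) {P : Type*} [PartialOrder P] (h : P → ℤ × ℤ) : Prop :=
  (∀ z : ℤ × ℤ, IsChain (· ≤ ·) {p : P | CylRel k n (h p) z}) ∧
  (∀ p q : P, ¬CylRel k n (h p) (h q) → (p ≤ q ↔ CylLe k n (h p) (h q))) ∧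
  (∀ (p q : P) (z : ℤ × ℤ), CylLe k n (h p) z → CylLe k n z (h q) →
    ∃ w : P, CylRel k n (h w) z)

/-- `q` covers `p` in the reduced poset determined by `h` (whose elements are the fibers,
i.e. the classes of the relation `CylRel k n (h ·) (h ·)`). -/
def CylCov (k n : ℕ) {P : Type*} [PartialOrder P] (h : P → ℤ × ℤ) (p q : P) : Prop :=
  (¬CylRel k n (h p) (h q) ∧ CylLe k n (h p) (h q)) ∧
  ∀ v : P, ¬((¬CylRel k n (h p) (h v) ∧ CylLe k n (h p) (h v)) ∧
    (¬CylRel k n (h v) (h q) ∧ CylLe k n (h v) (h q)))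

/-- The number of elements of the chain of `P` into which the element of the reduced poset
represented by `p` splits. -/
noncomputable def splitSize (k n : ℕ) {P : Type*} [PartialOrder P] (h : P → ℤ × ℤ) (p : P) : ℕ :=
  {q : P | CylRel k n (h q) (h p)}.ncard

/-- The technical condition: for every four-element diamond `{w ⋖ x, y ⋖ z}` of the reduced
poset that does not go around the cylinder (i.e. that has representatives forming a diamond
in `ℤ²`), `max {s(w), s(z)} ≤ min {s(x), s(y)}`. -/
def TechCondition (k n : ℕ) {P : Type*} [PartialOrder P] (h : P → ℤ × ℤ) : Prop :=
  ∀ w x y z : P,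
    CylCov k n h w x → CylCov k n h w y → CylCov k n h x z → CylCov k n h y z →
    ¬CylRel k n (h x) (h y) →
    (∀ v : P, CylLe k n (h w) (h v) → CylLe k n (h v) (h z) →
      CylRel k n (h v) (h w) ∨ CylRel k n (h v) (h x) ∨
        CylRel k n (h v) (h y) ∨ CylRel k n (h v) (h z)) →
    (∃ pw px py pz : ℤ × ℤ, CylRel k n (h w) pw ∧ CylRel k n (h x) px ∧
      CylRel k n (h y) py ∧ CylRel k n (h z) pz ∧
      pw ⋖ px ∧ pw ⋖ py ∧ px ⋖ pz ∧ py ⋖ pz ∧ px ≠ py) →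
    max (splitSize k n h w) (splitSize k n h z) ≤
      min (splitSize k n h x) (splitSize k n h y)

/-- The relation `R` is the partition of a poset into saturated chains. -/
structure ChainRel {P : Type*} [PartialOrder P] (R : P → P → Prop) : Prop where
  refl : ∀ p, R p p
  symm : ∀ {p q}, R p q → R q p
  trans : ∀ {p q r}, R p q → R q r → R p r
  total : ∀ {p q}, R p q → p ≤ q ∨ q ≤ p
  sat : ∀ {p q}, R p q → p < q → (∀ z, R p z → ¬(p < z ∧ z < q)) → p ⋖ q

namespace ChainRel

variable {P : Type*} [PartialOrder P] {R : P → P → Prop}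

theorem dual (h : ChainRel R) : @ChainRel Pᵒᵈ _ R where
  refl := h.refl
  symm := h.symm
  trans := h.trans
  total := fun {p q} hpq => (@total P _ R h p q hpq).symm
  sat := fun {p q} hpq hlt hz =>
    (@sat P _ R h q p (h.symm hpq) hlt
      (fun z hqz hh => hz z (h.trans hpq hqz) ⟨hh.2, hh.1⟩)).toDual

/-- In a saturated chain, a cover of `p` lies below every larger element of the chain. -/
theorem cover_le (h : ChainRel R) {p q v : P} (hpq : p ⋖ q) (h1 : R p q) (h2 : R p v)
    (hv : p < v) : q ≤ v := by
  rcases h.total (h.trans (h.symm h1) h2) with h3 | h3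
  · exact h3
  · rcases h3.eq_or_lt with rfl | h4
    · exact le_rfl
    · exact absurd h4 (hpq.2 hv)

theorem cover_unique (h : ChainRel R) {p q v : P} (hpq : p ⋖ q) (h1 : R p q) (hpv : p ⋖ v)
    (h2 : R p v) : q = v :=
  le_antisymm (h.cover_le hpq h1 h2 hpv.lt) (h.cover_le hpv h2 h1 hpq.lt)

theorem exists_succ [Finite P] (h : ChainRel R) {p q : P} (h1 : R p q) (hlt : p < q) :
    ∃ s, p ⋖ s ∧ R p s ∧ s ≤ q := by
  obtain ⟨s, hs⟩ := (Set.toFinite {z | R p z ∧ p < z}).exists_minimal ⟨q, h1, hlt⟩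
  have hc : p ⋖ s := h.sat hs.prop.1 hs.prop.2 fun z hz hzz =>
    absurd (hs.le_of_le ⟨hz, hzz.1⟩ hzz.2.le) (not_le_of_gt hzz.2)
  exact ⟨s, hc, hs.prop.1, h.cover_le hc hs.prop.1 h1 hlt⟩

end ChainRel

/-- Two elements lie in a common chain of `C`. -/
def SameChain {P : Type*} (C : Set (Set P)) (p q : P) : Prop := ∃ c ∈ C, p ∈ c ∧ q ∈ c

theorem IsChainCover.chainRel {P : Type*} [PartialOrder P] {C : Set (Set P)}
    (hC : IsChainCover P C) : ChainRel (SameChain C) := by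
  obtain ⟨h1, h2, h3⟩ := hC
  have key : ∀ {c d : Set P} {p : P}, c ∈ C → d ∈ C → p ∈ c → p ∈ d → c = d := by
    intro c d p hc hd hpc hpd
    by_contra hne
    exact Set.disjoint_left.1 (h2 hc hd hne) hpc hpd
  refine ⟨?_, ?_, ?_, ?_, ?_⟩
  · intro p
    obtain ⟨c, hc, hp⟩ := h3 p
    exact ⟨c, hc, hp, hp⟩
  · rintro p q ⟨c, hc, hp, hq⟩
    exact ⟨c, hc, hq, hp⟩
  · rintro p q r ⟨c, hc, hp, hq⟩ ⟨d, hd, hq', hr⟩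
    obtain rfl := key hc hd hq hq'
    exact ⟨c, hc, hp, hr⟩
  · rintro p q ⟨c, hc, hp, hq⟩
    by_cases hpq : p = q
    · exact Or.inl hpq.le
    · exact (h1 c hc).1 hp hq hpq
  · rintro p q ⟨c, hc, hp, hq⟩ hlt hz
    exact (h1 c hc).2 p hp q hq hlt fun z hzc => hz z ⟨c, hc, hp, hzc⟩

/-- The chain cover whose chains are the classes of `R`. -/
def classes {P : Type*} (R : P → P → Prop) : Set (Set P) := Set.range fun p => {q | R p q}

theorem ChainRel.sameChain_classes {P : Type*} [PartialOrder P] {R : P → P → Prop}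
    (h : ChainRel R) (p q : P) : SameChain (classes R) p q ↔ R p q := by
  constructor
  · rintro ⟨_, ⟨r, rfl⟩, hp, hq⟩
    exact h.trans (h.symm hp) hq
  · intro hpq
    exact ⟨_, ⟨p, rfl⟩, h.refl p, hpq⟩

theorem ChainRel.isChainCover_classes {P : Type*} [PartialOrder P] {R : P → P → Prop}
    (h : ChainRel R) : IsChainCover P (classes R) := by
  refine ⟨?_, ?_, fun x => ⟨_, ⟨x, rfl⟩, h.refl x⟩⟩
  · rintro _ ⟨r, rfl⟩
    refine ⟨fun p hp q hq _ => h.total (h.trans (h.symm hp) hq), ?_⟩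
    intro p hp q hq hlt hz
    exact h.sat (h.trans (h.symm hp) hq) hlt fun z hpz => hz z (h.trans hp hpz)
  · rintro _ ⟨p, rfl⟩ _ ⟨q, rfl⟩ hne
    refine Set.disjoint_left.2 fun z hp hq => hne ?_
    ext v
    exact ⟨fun hv => h.trans hq (h.trans (h.symm hp) hv),
      fun hv => h.trans hp (h.trans (h.symm hq) hv)⟩

/-- The combinatorial form of the non-messing-up property: for every up-set `U` of the chains
of `R`, pushing the elements of `U` to the top of each chain of `B` gives again an up-set of the
chains of `R`. -/
def PushUp {P : Type*} [PartialOrder P] (R B : P → P → Prop) : Prop :=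
  ∀ U : Set P, (∀ p q, R p q → p ≤ q → p ∈ U → q ∈ U) → ∀ y z, R y z → y ≤ z →
    {v | B y v ∧ y ≤ v}.ncard ≤ {v | B y v ∧ v ∈ U}.ncard →
    {v | B z v ∧ z ≤ v}.ncard ≤ {v | B z v ∧ v ∈ U}.ncard

/-- A labeling can be sorted along the classes of a partition. -/
theorem exists_perm_sorted {P : Type*} [PartialOrder P] [Finite P] (B : P → P → Prop)
    (hrefl : ∀ p, B p p) (hsymm : ∀ p q, B p q → B q p)
    (htrans : ∀ p q r, B p q → B q r → B p r) (lam : P → ℝ) :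
    ∃ σ : Equiv.Perm P, (∀ x, B x (σ x)) ∧ ∀ x y, B x y → x ≤ y → lam (σ x) ≤ lam (σ y) := by
  classical
  have := Fintype.ofFinite P
  let rk : P → ℝ := fun p => ((Finset.univ.filter fun v => v < p).card : ℝ)
  have hrk : ∀ x y, x < y → rk x < rk y := by
    intro x y hxy
    refine Nat.cast_lt.2 (Finset.card_lt_card ?_)
    refine Finset.ssubset_iff_of_subset (fun v hv => ?_) |>.2 ⟨x, ?_, ?_⟩
    · simp only [Finset.mem_filter, Finset.mem_univ, true_and] at hv ⊢
      exact hv.trans hxy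
    · simpa using hxy
    · simp
  obtain ⟨σ, hσ, hmax⟩ := Finset.exists_max_image
    (Finset.univ.filter fun σ : Equiv.Perm P => ∀ x, B x (σ x))
    (fun σ => ∑ p, lam (σ p) * rk p) ⟨1, by simpa using hrefl⟩
  simp only [Finset.mem_filter, Finset.mem_univ, true_and] at hσ hmax
  refine ⟨σ, hσ, fun x y hB hxy => ?_⟩
  by_contra hlt
  push Not at hlt
  have hne : x ≠ y := by
    rintro rfl
    exact lt_irrefl _ hlt
  have hxy' : x < y := lt_of_le_of_ne hxy hne
  have h1 := hmax (σ * Equiv.swap x y) (by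
    intro v
    simp only [Equiv.Perm.coe_mul, Function.comp_apply]
    rcases eq_or_ne v x with rfl | h1
    · rw [Equiv.swap_apply_left]
      exact htrans _ _ _ hB (hσ _)
    · rcases eq_or_ne v y with rfl | h2
      · rw [Equiv.swap_apply_right]
        exact htrans _ _ _ (hsymm _ _ hB) (hσ _)
      · rw [Equiv.swap_apply_of_ne_of_ne h1 h2]
        exact hσ _)
  have h2 : ∑ p, lam ((σ * Equiv.swap x y) p) * rk p - ∑ p, lam (σ p) * rk p
      = (lam (σ x) - lam (σ y)) * (rk y - rk x) := by
    rw [← Finset.sum_sub_distrib]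
    rw [← Finset.sum_subset (Finset.subset_univ {x, y})]
    · rw [Finset.sum_pair hne]
      simp only [Equiv.Perm.coe_mul, Function.comp_apply, Equiv.swap_apply_left,
        Equiv.swap_apply_right]
      ring
    · intro v _ hv
      simp only [Finset.mem_insert, Finset.mem_singleton, not_or] at hv
      simp only [Equiv.Perm.coe_mul, Function.comp_apply]
      rw [Equiv.swap_apply_of_ne_of_ne hv.1 hv.2, sub_self]
  have h3 := mul_pos (sub_pos.2 hlt) (sub_pos.2 (hrk x y hxy'))
  linarith

theorem pushUp_iff {P : Type*} [PartialOrder P] [Finite P] {C₁ C₂ : Set (Set P)}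
    (h₁ : IsChainCover P C₁) (h₂ : IsChainCover P C₂) :
    (∀ lam mu nu : P → ℝ, IsCSort P C₁ lam mu → IsCSort P C₂ mu nu → SortedAlong P C₁ nu) ↔
      PushUp (SameChain C₁) (SameChain C₂) := by
  classical
  have c₁ := h₁.chainRel
  have c₂ := h₂.chainRel
  constructor
  · intro H U hU y z hyz hle hcard
    let mu : P → ℝ := fun v => if v ∈ U then 1 else 0
    obtain ⟨σ, hσ, hs⟩ := exists_perm_sorted (SameChain C₂) c₂.refl (fun _ _ => c₂.symm)
      (fun _ _ _ => c₂.trans) mu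
    have hnu := H mu mu (fun v => mu (σ v))
      ⟨1, fun _ _ _ hx => hx, fun _ => rfl, fun c hc x hx y hy hxy => ?_⟩
      ⟨σ, fun c hc x hx => ?_, fun _ => rfl, fun c hc x hx y hy hxy => hs x y ⟨c, hc, hx, hy⟩ hxy⟩
    · have count : ∀ y, {v | SameChain C₂ y v ∧ v ∈ U}.ncard
          = {v | SameChain C₂ y v ∧ σ v ∈ U}.ncard := by
        intro y
        rw [← Set.ncard_image_of_injective {v | SameChain C₂ y v ∧ σ v ∈ U} σ.injective]
        congr 1
        ext v
        constructor
        · rintro ⟨hv1, hv2⟩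
          have := hσ (σ.symm v)
          rw [σ.apply_symm_apply] at this
          exact ⟨σ.symm v, ⟨c₂.trans hv1 (c₂.symm this), by simpa using hv2⟩, by simp⟩
        · rintro ⟨w, ⟨hw1, hw2⟩, rfl⟩
          exact ⟨c₂.trans hw1 (hσ w), hw2⟩
      rw [count] at hcard ⊢
      have hy : σ y ∈ U := by
        by_contra hy
        have hsub : {v | SameChain C₂ y v ∧ σ v ∈ U} ⊂ {v | SameChain C₂ y v ∧ y ≤ v} := by
          refine Set.ssubset_iff_of_subset ?_ |>.2 ⟨y, ⟨c₂.refl y, le_rfl⟩, fun h => hy h.2⟩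
          rintro v ⟨hv1, hv2⟩
          refine ⟨hv1, ?_⟩
          rcases c₂.total hv1 with h | h
          · exact h
          · have := hs v y (c₂.symm hv1) h
            simp only [mu, hv2, hy, if_true, if_false] at this
            linarith
        exact absurd (Set.ncard_lt_ncard hsub) (not_lt.2 hcard)
      have hz : σ z ∈ U := by
        obtain ⟨c, hc, hyc, hzc⟩ := hyz
        have := hnu c hc y hyc z hzc hle
        by_contra hz
        simp only [mu, hy, hz, if_true, if_false] at this
        linarith
      refine Set.ncard_le_ncard ?_
      rintro v ⟨hv1, hv2⟩
      refine ⟨hv1, ?_⟩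
      have := hs z v hv1 hv2
      by_contra hv
      simp only [mu, hz, hv, if_true, if_false] at this
      linarith
    · by_cases hxU : x ∈ U
      · have hyU := hU x y ⟨c, hc, hx, hy⟩ hxy hxU
        simp [mu, hxU, hyU]
      · simp only [mu, hxU, if_false]
        split_ifs <;> norm_num
    · obtain ⟨d, hd, h1, h2⟩ := hσ x
      by_contra hne
      have hcd : c ≠ d := by
        rintro rfl
        exact hne h2
      exact Set.disjoint_left.1 (h₂.2.1 hc hd hcd) hx h1
  · rintro H lam mu nu ⟨-, -, -, hmu⟩ ⟨σ, hσ, hnu, hnus⟩ c hc y hy z hz hyz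
    by_contra hlt
    push Not at hlt
    have count : ∀ y, {v | SameChain C₂ y v ∧ v ∈ {v | nu z < mu v}}.ncard
        = {v | SameChain C₂ y v ∧ nu z < nu v}.ncard := by
      intro y
      have hσ' : ∀ v, SameChain C₂ v (σ v) := fun v => by
        obtain ⟨c, hc, hv, -⟩ := c₂.refl v
        exact ⟨c, hc, hv, hσ c hc v hv⟩
      rw [← Set.ncard_image_of_injective {v | SameChain C₂ y v ∧ nu z < nu v} σ.injective]
      congr 1
      ext v
      constructor
      · rintro ⟨hv1, hv2⟩
        have := hσ' (σ.symm v)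
        rw [σ.apply_symm_apply] at this
        refine ⟨σ.symm v, ⟨c₂.trans hv1 (c₂.symm this), ?_⟩, by simp⟩
        rw [hnu (σ.symm v), σ.apply_symm_apply]
        exact hv2
      · rintro ⟨w, ⟨hw1, hw2⟩, rfl⟩
        refine ⟨c₂.trans hw1 (hσ' w), ?_⟩
        rw [hnu w] at hw2
        exact hw2
    have h1 := H {v | nu z < mu v} (fun p q ⟨d, hd, hp, hq⟩ hpq hpU =>
      lt_of_lt_of_le hpU (hmu d hd p hp q hq hpq)) y z ⟨c, hc, hy, hz⟩ hyz
    rw [count, count] at h1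
    have h2 := h1 (Set.ncard_le_ncard (by
      rintro v ⟨⟨d, hd, hyd, hvd⟩, hv2⟩
      exact ⟨⟨d, hd, hyd, hvd⟩, lt_of_lt_of_le hlt (hnus d hd y hyd v hvd hv2)⟩))
    have hsub : {v | SameChain C₂ z v ∧ nu z < nu v} ⊂ {v | SameChain C₂ z v ∧ z ≤ v} := by
      refine Set.ssubset_iff_of_subset ?_ |>.2 ⟨z, ⟨c₂.refl z, le_rfl⟩, fun h => lt_irrefl _ h.2⟩
      rintro v ⟨hv1, hv2⟩
      refine ⟨hv1, ?_⟩
      rcases c₂.total hv1 with h | h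
      · exact h
      · obtain ⟨d, hd, hzd, hvd⟩ := hv1
        exact absurd (hnus d hd v hvd z hzd h) (not_le.2 hv2)
    exact absurd (Set.ncard_lt_ncard hsub) (not_lt.2 h2)

/-- The non-messing-up property in terms of partitions into saturated chains. -/
theorem inN2_iff {P : Type*} [PartialOrder P] [Finite P] :
    InN2 P ↔ ∃ R B : P → P → Prop, ChainRel R ∧ ChainRel B ∧ PushUp R B ∧ PushUp B R ∧
      ∀ x y : P, x ⋖ y → R x y ∨ B x y := by
  constructor
  · rintro ⟨C₁, C₂, h1, h2, h3, h4, h5⟩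
    refine ⟨SameChain C₁, SameChain C₂, h1.chainRel, h2.chainRel, (pushUp_iff h1 h2).1 h3,
      (pushUp_iff h2 h1).1 h4, fun x y hxy => ?_⟩
    obtain ⟨c, hc | hc, hx, hy⟩ := h5 x y hxy
    · exact Or.inl ⟨c, hc, hx, hy⟩
    · exact Or.inr ⟨c, hc, hx, hy⟩
  · rintro ⟨R, B, hR, hB, h3, h4, h5⟩
    have eR : SameChain (classes R) = R := by
      ext p q
      exact hR.sameChain_classes p q
    have eB : SameChain (classes B) = B := by
      ext p q
      exact hB.sameChain_classes p q
    refine ⟨classes R, classes B, hR.isChainCover_classes, hB.isChainCover_classes,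
      (pushUp_iff hR.isChainCover_classes hB.isChainCover_classes).2 (by rwa [eR, eB]),
      (pushUp_iff hB.isChainCover_classes hR.isChainCover_classes).2 (by rwa [eR, eB]),
      fun x y hxy => ?_⟩
    rcases h5 x y hxy with h | h
    · exact ⟨_, Or.inl ⟨x, rfl⟩, hR.refl x, h⟩
    · exact ⟨_, Or.inr ⟨x, rfl⟩, hB.refl x, h⟩

section Local

variable {P : Type*} [PartialOrder P] {R B : P → P → Prop}

/-- Passing to complements, pushing down the elements of down-sets is the same as pushing up
those of up-sets. -/
theorem PushUp.dual [Finite P] (hR : ChainRel R) (hB : ChainRel B) (h : PushUp R B) :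
    @PushUp Pᵒᵈ _ R B := by
  intro U hU y z hyz hle hcard
  change P at y z
  change Set P at U
  change z ≤ y at hle
  change {v : P | B y v ∧ v ≤ y}.ncard ≤ {v : P | B y v ∧ v ∈ U}.ncard at hcard
  change {v : P | B z v ∧ v ≤ z}.ncard ≤ {v : P | B z v ∧ v ∈ U}.ncard
  have split : ∀ (S : Set P) (x : P), {v | B x v}.ncard
      = {v | B x v ∧ v ∈ S}.ncard + {v | B x v ∧ v ∉ S}.ncard := by
    intro S x
    rw [← Set.ncard_union_eq]
    · congr 1
      ext v
      simp only [Set.mem_ofPred_eq, Set.mem_union]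
      tauto
    · exact Set.disjoint_left.2 fun v h1 h2 => h2.2 h1.2
  have above : ∀ x : P, {v | B x v ∧ x ≤ v}.ncard = {v | B x v ∧ v ∉ {v | v ≤ x}}.ncard + 1 := by
    intro x
    rw [← Set.ncard_insert_of_notMem (a := x) (by simp)]
    congr 1
    ext v
    simp only [Set.mem_ofPred_eq, Set.mem_insert_iff]
    constructor
    · rintro ⟨h1, h2⟩
      rcases h2.eq_or_lt with h3 | h3
      · exact Or.inl h3.symm
      · exact Or.inr ⟨h1, not_le_of_gt h3⟩
    · rintro (rfl | ⟨h1, h2⟩)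
      · exact ⟨hB.refl _, le_rfl⟩
      · exact ⟨h1, (hB.total h1).resolve_right h2⟩
  have h1 := h Uᶜ (fun p q hpq hle hp hq => hp (hU q p (hR.symm hpq) hle hq)) z y
    (hR.symm hyz) hle
  by_contra hlt
  push Not at hlt
  have a1 := split U y
  have a2 := split U z
  have b1 := split {v | v ≤ y} y
  have b2 := split {v | v ≤ z} z
  have c1 := above y
  have c2 := above z
  simp only [Set.mem_ofPred_eq, Set.mem_compl_iff] at *
  have := h1 (by omega)
  omega

/-- If `w` is below `y` in its `B`-chain and `z` covers `y` in its `R`-chain, then one can also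
go from `w` to `z` by first following an `R`-chain and then a `B`-chain. -/
theorem exists_corner [Finite P] (hR : ChainRel R) (hB : ChainRel B) (hp : PushUp R B)
    {w y z : P} (hyz : y ⋖ z) (h1 : R y z) (h2 : ¬B y z) (hwy : w < y) (h3 : B w y)
    (h4 : ¬R w y) : ∃ v, R w v ∧ B v z ∧ w < v ∧ v < z := by
  let U : Set P := {v | (R w v ∧ w ≤ v) ∨ ∃ u, B y u ∧ y < u ∧ R u v ∧ u ≤ v}
  have hU := hp U (by
    rintro p q hpq hle (⟨h5, h6⟩ | ⟨u, h5, h6, h7, h8⟩)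
    · exact Or.inl ⟨hR.trans h5 hpq, h6.trans hle⟩
    · exact Or.inr ⟨u, h5, h6, hR.trans h7 hpq, h8.trans hle⟩) y z h1 hyz.le (by
    have e : {v | B y v ∧ y ≤ v}.ncard = (insert w {v | B y v ∧ y < v}).ncard := by
      rw [Set.ncard_insert_of_notMem (fun h => lt_asymm h.2 hwy),
        ← Set.ncard_insert_of_notMem (a := y) (fun h => lt_irrefl _ h.2)]
      congr 1
      ext v
      simp only [Set.mem_ofPred_eq, Set.mem_insert_iff, le_iff_lt_or_eq]
      constructor
      · rintro ⟨h5, h6 | h6⟩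
        · exact Or.inr ⟨h5, h6⟩
        · exact Or.inl h6.symm
      · rintro (rfl | ⟨h5, h6⟩)
        · exact ⟨hB.refl _, Or.inr rfl⟩
        · exact ⟨h5, Or.inl h6⟩
    rw [e]
    refine Set.ncard_le_ncard ?_
    rintro v (rfl | ⟨h5, h6⟩)
    · exact ⟨hB.symm h3, Or.inl ⟨hR.refl _, le_rfl⟩⟩
    · exact ⟨h5, Or.inr ⟨v, h5, h6, hR.refl _, le_rfl⟩⟩)
  have hz : z ∉ U := by
    rintro (⟨h5, -⟩ | ⟨u, h5, h6, h7, h8⟩)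
    · exact h4 (hR.trans h5 (hR.symm h1))
    · rcases h8.eq_or_lt with rfl | h9
      · exact h2 h5
      · exact hyz.2 h6 h9
  by_contra hcon
  have hsub : {v | B z v ∧ v ∈ U} ⊂ {v | B z v ∧ z ≤ v} := by
    refine Set.ssubset_iff_of_subset ?_ |>.2 ⟨z, ⟨hB.refl z, le_rfl⟩, fun h => hz h.2⟩
    rintro v ⟨hv1, hv2⟩
    refine ⟨hv1, ?_⟩
    by_contra hzv
    have hvz : v < z := lt_of_le_not_ge ((hB.total hv1).resolve_left hzv) hzv
    rcases hv2 with ⟨h5, h6⟩ | ⟨u, h5, h6, h7, h8⟩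
    · rcases h6.eq_or_lt with rfl | h7
      · exact h2 (hB.trans (hB.symm h3) (hB.symm hv1))
      · exact hcon ⟨v, h5, hB.symm hv1, h7, hvz⟩
    · exact hyz.2 (h6.trans_le h8) hvz
  exact absurd (Set.ncard_lt_ncard hsub) (not_lt.2 hU)

/-- `p ≤ q`, and the whole interval from `p` to `q` lies in the chain of `p` for both `R` and
`B`. -/
def DoubleInterval (R B : P → P → Prop) (p q : P) : Prop :=
  p ≤ q ∧ ∀ v, p ≤ v → v ≤ q → R p v ∧ B p v

/-- `p` and `q` belong to the splitting of a single element of the reduced poset. -/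
def SameFiber (R B : P → P → Prop) (p q : P) : Prop :=
  DoubleInterval R B p q ∨ DoubleInterval R B q p

namespace DoubleInterval

theorem dual (hR : ChainRel R) (hB : ChainRel B) {p q : P} (h : DoubleInterval R B p q) :
    @DoubleInterval Pᵒᵈ _ R B q p :=
  ⟨h.1, fun v hv1 hv2 => ⟨hR.trans (hR.symm (h.2 q h.1 le_rfl).1) (h.2 v hv2 hv1).1,
    hB.trans (hB.symm (h.2 q h.1 le_rfl).2) (h.2 v hv2 hv1).2⟩⟩

theorem swap {p q : P} (h : DoubleInterval R B p q) : DoubleInterval B R p q :=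
  ⟨h.1, fun v hv1 hv2 => (h.2 v hv1 hv2).symm⟩

theorem le_or_le [Finite P] (hR : ChainRel R) (hB : ChainRel B)
    (hcov : ∀ x y : P, x ⋖ y → R x y ∨ B x y) {p q v : P} (h : DoubleInterval R B p q)
    (hv : p ≤ v) : v ≤ q ∨ q ≤ v := by
  obtain ⟨u, hu⟩ := (Set.toFinite {u | p ≤ u ∧ u ≤ q ∧ u ≤ v}).exists_maximal
    ⟨p, le_rfl, h.1, hv⟩
  obtain ⟨h1, h2, h3⟩ := hu.prop
  rcases h2.eq_or_lt with rfl | h2'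
  · exact Or.inr h3
  rcases h3.eq_or_lt with rfl | h3'
  · exact Or.inl h2
  exfalso
  have hq := h.2 q h.1 le_rfl
  have hpu := h.2 u h1 h2
  obtain ⟨s, hs⟩ := (Set.toFinite {s | u < s ∧ s ≤ v}).exists_minimal ⟨v, h3', le_rfl⟩
  have hus : u ⋖ s := ⟨hs.prop.1, fun t ht1 ht2 =>
    absurd (hs.le_of_le ⟨ht1, ht2.le.trans hs.prop.2⟩ ht2.le) (not_le_of_gt ht2)⟩
  have hsq : s ≤ q := by
    rcases hcov u s hus with h4 | h4
    · exact hR.cover_le hus h4 (hR.trans (hR.symm hpu.1) hq.1) h2'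
    · exact hB.cover_le hus h4 (hB.trans (hB.symm hpu.2) hq.2) h2'
  exact absurd (hu.le_of_ge ⟨h1.trans hs.prop.1.le, hsq, hs.prop.2⟩ hs.prop.1.le)
    (not_le_of_gt hs.prop.1)

theorem le_or_le' [Finite P] (hR : ChainRel R) (hB : ChainRel B)
    (hcov : ∀ x y : P, x ⋖ y → R x y ∨ B x y) {p q v : P} (h : DoubleInterval R B p q)
    (hv : v ≤ q) : v ≤ p ∨ p ≤ v :=
  (@le_or_le Pᵒᵈ _ R B _ hR.dual hB.dual (fun x y hxy =>
    (hcov y x hxy.ofDual).imp (@ChainRel.symm P _ R hR y x) (@ChainRel.symm P _ B hB y x))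
    q p v (h.dual hR hB) hv).symm

theorem rel {p q : P} (h : DoubleInterval R B p q) : R p q ∧ B p q := h.2 q h.1 le_rfl

theorem trans [Finite P] (hR : ChainRel R) (hB : ChainRel B)
    (hcov : ∀ x y : P, x ⋖ y → R x y ∨ B x y) {p q r : P} (h1 : DoubleInterval R B p q)
    (h2 : DoubleInterval R B q r) : DoubleInterval R B p r := by
  refine ⟨h1.1.trans h2.1, fun v hpv hvr => ?_⟩
  rcases h1.le_or_le hR hB hcov hpv with h | h
  · exact h1.2 v hpv h
  · exact ⟨hR.trans h1.rel.1 (h2.2 v h hvr).1, hB.trans h1.rel.2 (h2.2 v h hvr).2⟩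

theorem left {p q r : P} (h : DoubleInterval R B p r) (hpq : p ≤ q) (hqr : q ≤ r) :
    DoubleInterval R B p q :=
  ⟨hpq, fun v h1 h2 => h.2 v h1 (h2.trans hqr)⟩

theorem right (hR : ChainRel R) (hB : ChainRel B) {p q r : P} (h : DoubleInterval R B p r)
    (hpq : p ≤ q) (hqr : q ≤ r) : DoubleInterval R B q r :=
  ⟨hqr, fun v h1 h2 => ⟨hR.trans (hR.symm (h.2 q hpq hqr).1) (h.2 v (hpq.trans h1) h2).1,
    hB.trans (hB.symm (h.2 q hpq hqr).2) (h.2 v (hpq.trans h1) h2).2⟩⟩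

end DoubleInterval

namespace SameFiber

theorem rel (hR : ChainRel R) (hB : ChainRel B) {p q : P} (h : SameFiber R B p q) :
    R p q ∧ B p q := by
  rcases h with h | h
  · exact h.rel
  · exact ⟨hR.symm h.rel.1, hB.symm h.rel.2⟩

theorem swap {p q : P} (h : SameFiber R B p q) : SameFiber B R p q :=
  h.imp DoubleInterval.swap DoubleInterval.swap

theorem dual (hR : ChainRel R) (hB : ChainRel B) {p q : P} (h : SameFiber R B p q) :
    @SameFiber Pᵒᵈ _ R B p q :=
  h.symm.imp (DoubleInterval.dual hR hB) (DoubleInterval.dual hR hB)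

theorem comparable {p q : P} (h : SameFiber R B p q) : p ≤ q ∨ q ≤ p :=
  h.imp And.left And.left

theorem equivalence [Finite P] (hR : ChainRel R) (hB : ChainRel B)
    (hcov : ∀ x y : P, x ⋖ y → R x y ∨ B x y) : Equivalence (SameFiber R B) where
  refl p := Or.inl ⟨le_rfl, fun v h1 h2 => by
    obtain rfl := le_antisymm h1 h2
    exact ⟨hR.refl _, hB.refl _⟩⟩
  symm h := h.symm
  trans := by
    rintro p q r (h1 | h1) (h2 | h2)
    · exact Or.inl (h1.trans hR hB hcov h2)
    · rcases h2.le_or_le' hR hB hcov h1.1 with h | h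
      · exact Or.inl (h1.left h h2.1)
      · exact Or.inr (h2.left h h1.1)
    · rcases h1.le_or_le hR hB hcov h2.1 with h | h
      · exact Or.inr (h1.right hR hB h2.1 h)
      · exact Or.inl (h2.right hR hB h1.1 h)
    · exact Or.inr (h2.trans hR hB hcov h1)

/-- Elements of a fiber have the same elements above them outside the fiber. -/
theorem le_of_le [Finite P] (hR : ChainRel R) (hB : ChainRel B)
    (hcov : ∀ x y : P, x ⋖ y → R x y ∨ B x y) {p q v : P} (h : SameFiber R B p q)
    (hv : ¬SameFiber R B p v) (hpv : p ≤ v) : q ≤ v := by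
  rcases h with h | h
  · rcases h.le_or_le hR hB hcov hpv with h1 | h1
    · exact absurd (Or.inl (h.left hpv h1)) hv
    · exact h1
  · exact h.1.trans hpv

theorem ge_of_ge [Finite P] (hR : ChainRel R) (hB : ChainRel B)
    (hcov : ∀ x y : P, x ⋖ y → R x y ∨ B x y) {p q v : P} (h : SameFiber R B p q)
    (hv : ¬SameFiber R B p v) (hpv : v ≤ p) : v ≤ q := by
  rcases h with h | h
  · exact hpv.trans h.1
  · rcases h.le_or_le' hR hB hcov hpv with h1 | h1
    · exact h1
    · exact absurd (Or.inr (h.right hR hB h1 hpv)) hv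

end SameFiber

/-- In the situation `p -R→ q ≈ q' -B→ r`, the elements of the `B`-chain of `p` and of the
`R`-chain of `r` strictly between `p` and `r` form an up-set of the open interval. -/
theorem corner_up [Finite P] (hR : ChainRel R) (hB : ChainRel B) (hp : PushUp R B)
    (hcov : ∀ x y : P, x ⋖ y → R x y ∨ B x y) {p q q' r : P}
    (hpq : p ⋖ q) (h1 : R p q) (hqq : DoubleInterval R B q q')
    (hqr : q' ⋖ r) (h4 : ¬R q' r) {u v : P} (hpu : p < u) (hu1 : R u r) (hu2 : B p u)
    (huv : u ≤ v) (hvr : v < r) : R v r ∧ B p v := by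
  have avoid : ∀ x x' : P, p < x → R x r → B p x → x ⋖ x' → x' < r → R x x' → ¬B x x' →
      False := by
    intro x x' hpx hx1 hx2 hxx hx'r h5 h6
    obtain ⟨t, ht1, ht2, ht3, ht4⟩ := exists_corner hR hB hp hxx h5 h6 hpx hx2
      (fun h => h4 (hR.trans (hR.symm hqq.rel.1)
        (hR.trans (hR.symm h1) (hR.trans h (hx1)))))
    have hqt : q ≤ t := hR.cover_le hpq h1 ht1 ht3
    rcases hR.total (hR.trans (hR.symm ht1) (hR.trans h1 hqq.rel.1)) with h | h
    · have hB' : B q x' := hB.trans (hqq.2 t hqt h).2 ht2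
      rcases hB.total (hB.trans (hB.symm hqq.rel.2) hB') with h7 | h7
      · rcases h7.eq_or_lt with rfl | h8
        · exact h4 (hR.trans (hR.symm h5) hx1)
        · exact hqr.2 h8 hx'r
      · exact h4 (hR.trans (hR.symm hqq.rel.1) (hR.trans
          (hqq.2 x' (hqt.trans ht4.le) h7).1 (hR.trans (hR.symm h5) hx1)))
    · exact hqr.2 (h.trans_lt ht4) hx'r
  by_contra hcon
  obtain ⟨x, hx⟩ := (Set.toFinite {x | u ≤ x ∧ x ≤ v ∧ R x r ∧ B p x}).exists_maximal
    ⟨u, le_rfl, huv, hu1, hu2⟩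
  obtain ⟨a1, a2, a3, a4⟩ := hx.prop
  have hxv : x < v := lt_of_le_of_ne a2 fun h => hcon (h ▸ ⟨a3, a4⟩)
  have hpx := hpu.trans_le a1
  obtain ⟨s, hs⟩ := (Set.toFinite {s | x < s ∧ s ≤ v}).exists_minimal ⟨v, hxv, le_rfl⟩
  have hxs : x ⋖ s := ⟨hs.prop.1, fun t ht1 ht2 =>
    absurd (hs.le_of_le ⟨ht1, ht2.le.trans hs.prop.2⟩ ht2.le) (not_le_of_gt ht2)⟩
  have hsr : s < r := hs.prop.2.trans_lt hvr
  have hnot : ¬(R x s ∧ B x s) := fun ⟨b1, b2⟩ =>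
    absurd (hx.le_of_ge ⟨a1.trans hxs.le, hs.prop.2, hR.trans (hR.symm b1) a3, hB.trans a4 b2⟩
      hxs.le) (not_le_of_gt hxs.lt)
  by_cases b1 : R x s
  · exact avoid x s hpx a3 a4 hxs hsr b1 fun b2 => hnot ⟨b1, b2⟩
  · have b2 := (hcov x s hxs).resolve_left b1
    obtain ⟨t, ht1, ht2, ht3⟩ := hR.exists_succ a3 (hxs.lt.trans hsr)
    rcases ht3.eq_or_lt with rfl | ht4
    · exact ht1.2 hxs.lt hsr
    · by_cases b3 : B x t
      · exact b1 (hB.cover_unique hxs b2 ht1 b3 ▸ ht2)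
      · exact avoid x t hpx a3 a4 ht1 ht4 ht2 b3

/-- An `R`-edge followed by a `B`-edge can be completed to a square. -/
theorem exists_square [Finite P] (hR : ChainRel R) (hB : ChainRel B) (hp : PushUp R B)
    (hp' : PushUp B R) (hcov : ∀ x y : P, x ⋖ y → R x y ∨ B x y) {p q q' r : P}
    (hpq : p ⋖ q) (h1 : R p q) (h2 : ¬B p q) (hqq : SameFiber R B q q')
    (hqr : q' ⋖ r) (h3 : B q' r) (h4 : ¬R q' r) :
    ∃ a b, p ⋖ a ∧ B p a ∧ ¬R p a ∧ SameFiber R B a b ∧ b ⋖ r ∧ R b r ∧ ¬B b r := by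
  have hqq' : DoubleInterval R B q q' := by
    rcases hqq with h | h
    · exact h
    rcases h.1.eq_or_lt with rfl | hlt
    · exact h
    · rcases h.le_or_le hR hB hcov hqr.le with h5 | h5
      · exact absurd (h.2 r hqr.le h5).1 h4
      · rcases h5.eq_or_lt with rfl | h6
        · exact absurd h.rel.1 h4
        · exact absurd h6 (hqr.2 hlt)
  obtain ⟨x, hx1, hx2, hx3, hx4⟩ := exists_corner hB hR hp' hqr h3 h4 (hpq.lt.trans_le hqq'.1)
    (hR.trans h1 hqq'.rel.1) (fun h => h2 (hB.trans h (hB.symm hqq'.rel.2)))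
  have up : ∀ u v : P, p < u → R u r → B p u → u ≤ v → v < r → R v r ∧ B p v :=
    fun u v => corner_up hR hB hp hcov hpq h1 hqq' hqr h4
  have down : ∀ u v : P, u < r → B u p → R r u → v ≤ u → p < v → B v p ∧ R r v := by
    intro u v b1 b2 b3 b4 b5
    exact @corner_up Pᵒᵈ _ B R _ hB.dual hR.dual (hp'.dual hB hR)
      (fun x y hxy => ((hcov y x hxy.ofDual).imp (@ChainRel.symm P _ R hR y x)
        (@ChainRel.symm P _ B hB y x)).symm) r q' q p hqr.toDual (hB.symm h3)
      (hqq'.dual hR hB).swap hpq.toDual (fun h => h2 (hB.symm h)) u v b1 b2 b3 b4 b5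
  obtain ⟨a, ha⟩ := (Set.toFinite {v | p < v ∧ v < r ∧ R v r ∧ B p v}).exists_minimal
    ⟨x, hx3, hx4, hx2, hx1⟩
  obtain ⟨a1, a2, a3, a4⟩ := ha.prop
  obtain ⟨b, hab, hb⟩ := (Set.toFinite {v | p < v ∧ v < r ∧ R v r ∧ B p v}).exists_le_maximal
    ⟨a1, a2, a3, a4⟩
  obtain ⟨b1, b2, b3, b4⟩ := hb.prop
  refine ⟨a, b, ⟨a1, fun v hv1 hv2 => ?_⟩, a4, fun h => ?_, Or.inl ⟨hab, fun v hv1 hv2 => ?_⟩,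
    ⟨b2, fun v hv1 hv2 => ?_⟩, b3, fun h => ?_⟩
  · have := down a v a2 (hB.symm a4) (hR.symm a3) hv2.le hv1
    exact absurd (ha.le_of_le ⟨hv1, hv2.trans a2, hR.symm this.2, hB.symm this.1⟩ hv2.le)
      (not_le_of_gt hv2)
  · exact h4 (hR.trans (hR.symm (hR.trans h1 hqq'.rel.1)) (hR.trans h a3))
  · have := up a v a1 a3 a4 hv1 (hv2.trans_lt b2)
    exact ⟨hR.trans a3 (hR.symm this.1), hB.trans (hB.symm a4) this.2⟩
  · have := up b v b1 b3 b4 hv1.le hv2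
    exact absurd (hb.le_of_ge ⟨b1.trans hv1, hv2, this.1, this.2⟩ hv1.le)
      (not_le_of_gt hv1)
  · exact h2 (hB.trans (hB.trans b4 h) (hB.symm (hB.trans hqq'.rel.2 h3)))

end Local

section Grid

variable {F : Type*}

/-- A partial action of the lattice `ℤ²` on `F`, whose generators are the partial injections
`E` and `N`, for which every corner of two steps in positive directions can be completed to a
square, and which is free of directed cycles. -/
structure GridSteps (E N : F → F → Prop) : Prop where
  e_right : ∀ {f g g'}, E f g → E f g' → g = g'
  e_left : ∀ {f f' g}, E f g → E f' g → f = f'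
  n_right : ∀ {f g g'}, N f g → N f g' → g = g'
  n_left : ∀ {f f' g}, N f g → N f' g → f = f'
  en : ∀ {f g h}, E f g → N g h → ∃ m, N f m ∧ E m h
  ne : ∀ {f g h}, N f g → E g h → ∃ m, E f m ∧ N m h
  acyclic : ∀ f, ¬Relation.TransGen (fun a b => E a b ∨ N a b) f f

/-- `g` is reached from `f` by `a` steps along `E` and `b` steps along `N`, in some order. -/
inductive PosPath (E N : F → F → Prop) (f : F) : ℕ → ℕ → F → Prop
  | refl : PosPath E N f 0 0 f
  | e {a b g h} : PosPath E N f a b g → E g h → PosPath E N f (a + 1) b h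
  | n {a b g h} : PosPath E N f a b g → N g h → PosPath E N f a (b + 1) h

/-- `g` is reached from `f` by `a` steps along `E` and `b` reversed steps along `N`, in some
order. -/
inductive MixPath (E N : F → F → Prop) (f : F) : ℕ → ℕ → F → Prop
  | refl : MixPath E N f 0 0 f
  | e {a b g h} : MixPath E N f a b g → E g h → MixPath E N f (a + 1) b h
  | s {a b g h} : MixPath E N f a b g → N h g → MixPath E N f a (b + 1) h

/-- `g` is reached from `f` by a path, using steps along `E`, `N` and their converses, of total
displacement `d`. -/
inductive GridPath (E N : F → F → Prop) (f : F) : ℤ × ℤ → F → Prop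
  | refl : GridPath E N f 0 f
  | e {d g h} : GridPath E N f d g → E g h → GridPath E N f (d + (1, 0)) h
  | n {d g h} : GridPath E N f d g → N g h → GridPath E N f (d + (0, 1)) h
  | w {d g h} : GridPath E N f d g → E h g → GridPath E N f (d - (1, 0)) h
  | s {d g h} : GridPath E N f d g → N h g → GridPath E N f (d - (0, 1)) h

variable {E N : F → F → Prop}

namespace GridSteps

theorem swap (hG : GridSteps E N) : GridSteps N E where
  e_right := hG.n_right
  e_left := hG.n_left
  n_right := hG.e_right
  n_left := hG.e_left
  en := hG.ne
  ne := hG.en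
  acyclic f h := hG.acyclic f (Relation.TransGen.mono (fun _ _ => Or.symm) _ _ h)

theorem reverse (hG : GridSteps E N) : GridSteps (fun a b => E b a) (fun a b => N b a) where
  e_right := hG.e_left
  e_left := hG.e_right
  n_right := hG.n_left
  n_left := hG.n_right
  en h1 h2 := (hG.ne h2 h1).imp fun _ h => h.symm
  ne h1 h2 := (hG.en h2 h1).imp fun _ h => h.symm
  acyclic f h := hG.acyclic f (Relation.transGen_swap.1 h)

end GridSteps

namespace PosPath

theorem swap {f g a b} (h : PosPath E N f a b g) : PosPath N E f b a g := by
  induction h with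
  | refl => exact .refl
  | e _ h ih => exact ih.n h
  | n _ h ih => exact ih.e h

theorem pre_e {f m g a b} (hfm : E f m) (h : PosPath E N m a b g) : PosPath E N f (a + 1) b g := by
  induction h with
  | refl => exact refl.e hfm
  | e _ h ih => exact ih.e h
  | n _ h ih => exact ih.n h

theorem pre_n {f m g a b} (hfm : N f m) (h : PosPath E N m a b g) : PosPath E N f a (b + 1) g :=
  (pre_e hfm h.swap).swap

theorem reverse {f g a b} (h : PosPath E N f a b g) :
    PosPath (fun a b => E b a) (fun a b => N b a) g a b f := by
  induction h with
  | refl => exact .refl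
  | e _ h ih => exact pre_e (E := fun a b => E b a) h ih
  | n _ h ih => exact pre_n (N := fun a b => N b a) h ih

theorem slide (hG : GridSteps E N) {f g h b} (h1 : PosPath E N f 0 b g) (h2 : E g h) :
    ∃ m, E f m ∧ PosPath E N m 0 b h := by
  generalize ha : 0 = a at h1
  induction h1 generalizing h with
  | refl => exact ⟨h, h2, ha ▸ refl⟩
  | e => omega
  | n _ h3 ih =>
    obtain ⟨k, hk1, hk2⟩ := hG.ne h3 h2
    obtain ⟨m, hm1, hm2⟩ := ih hk1 ha
    exact ⟨m, hm1, ha ▸ (hm2.n hk2)⟩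

theorem first_e (hG : GridSteps E N) {f g a b} (h : PosPath E N f (a + 1) b g) :
    ∃ m, E f m ∧ PosPath E N m a b g := by
  generalize ha : a + 1 = a' at h
  induction h generalizing a with
  | refl => omega
  | @e a₁ b g h h1 h2 ih =>
    rcases a with _ | a
    · obtain rfl : a₁ = 0 := by omega
      exact slide hG h1 h2
    · obtain ⟨m, hm1, hm2⟩ := ih (a := a) (by omega)
      exact ⟨m, hm1, hm2.e h2⟩
  | n _ h2 ih =>
    obtain ⟨m, hm1, hm2⟩ := ih ha
    exact ⟨m, hm1, hm2.n h2⟩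

theorem eq_of_zero {f g} (h : PosPath E N f 0 0 g) : f = g := by
  cases h
  rfl

theorem toMix {f g a} (h : PosPath E N f a 0 g) : MixPath E N f a 0 g := by
  generalize hb : 0 = b at h
  induction h with
  | refl => exact hb ▸ .refl
  | e _ h ih => exact (ih hb).e h
  | n => omega

/-- A monotone path can be chosen to pass through any lattice point of its bounding box. -/
theorem split (hG : GridSteps E N) {f g a b a' b'} (h : PosPath E N f (a + a') (b + b') g) :
    ∃ m, PosPath E N f a b m ∧ PosPath E N m a' b' g := by
  induction a generalizing f with
  | zero =>
    induction b generalizing f with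
    | zero => exact ⟨f, refl, by simpa using h⟩
    | succ b ih =>
      rw [show b + 1 + b' = b + b' + 1 by omega] at h
      obtain ⟨m, hm1, hm2⟩ := first_e hG.swap h.swap
      obtain ⟨k, hk1, hk2⟩ := ih hm2.swap
      exact ⟨k, pre_n hm1 hk1, hk2⟩
  | succ a ih =>
    rw [show a + 1 + a' = a + a' + 1 by omega] at h
    obtain ⟨m, hm1, hm2⟩ := first_e hG h
    obtain ⟨k, hk1, hk2⟩ := ih hm2
    exact ⟨k, pre_e hm1 hk1, hk2⟩

theorem reflTransGen {f g a b} (h : PosPath E N f a b g) :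
    Relation.ReflTransGen (fun a b => E a b ∨ N a b) f g := by
  induction h with
  | refl => exact .refl
  | e _ h ih => exact ih.tail (Or.inl h)
  | n _ h ih => exact ih.tail (Or.inr h)

theorem eq_zero_of_cycle (hG : GridSteps E N) {f a b} (h : PosPath E N f a b f) :
    a = 0 ∧ b = 0 := by
  cases h with
  | refl => exact ⟨rfl, rfl⟩
  | e h1 h2 => exact absurd (Relation.TransGen.tail' h1.reflTransGen (Or.inl h2)) (hG.acyclic f)
  | n h1 h2 => exact absurd (Relation.TransGen.tail' h1.reflTransGen (Or.inr h2)) (hG.acyclic f)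

theorem gridPath {f g a b} (h : PosPath E N f a b g) : GridPath E N f ((a : ℤ), (b : ℤ)) g := by
  induction h with
  | refl => exact .refl
  | e _ h ih => simpa using ih.e h
  | n _ h ih => simpa using ih.n h

end PosPath

namespace MixPath

theorem pre_e {f m g a b} (hfm : E f m) (h : MixPath E N m a b g) : MixPath E N f (a + 1) b g := by
  induction h with
  | refl => exact refl.e hfm
  | e _ h ih => exact ih.e h
  | s _ h ih => exact ih.s h

theorem pre_s {f m g a b} (hfm : N m f) (h : MixPath E N m a b g) : MixPath E N f a (b + 1) g := by
  induction h with
  | refl => exact refl.s hfm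
  | e _ h ih => exact ih.e h
  | s _ h ih => exact ih.s h

theorem swap {f g a b} (h : MixPath E N f a b g) : MixPath N E g b a f := by
  induction h with
  | refl => exact .refl
  | e _ h ih => exact pre_s h ih
  | s _ h ih => exact pre_e h ih

theorem reverse {f g a b} (h : MixPath E N f a b g) :
    MixPath (fun a b => E b a) (fun a b => N b a) g a b f := by
  induction h with
  | refl => exact .refl
  | e _ h ih => exact pre_e (E := fun a b => E b a) h ih
  | s _ h ih => exact pre_s (N := fun a b => N b a) h ih

theorem toPos {f g b} (h : MixPath E N f 0 b g) : PosPath E N g 0 b f := by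
  generalize ha : 0 = a at h
  induction h with
  | refl => exact ha ▸ .refl
  | e => omega
  | s _ h ih => exact PosPath.pre_n h (ih ha)

theorem cancel_e (hG : GridSteps E N) {f g h a b} (h1 : MixPath E N g (a + 1) b f) (h2 : E g h) :
    MixPath E N h a b f := by
  generalize ha : a + 1 = a' at h1
  induction h1 generalizing a with
  | refl => omega
  | @e a₁ b f₁ f h3 h4 ih =>
    obtain rfl : a = a₁ := by omega
    rcases a with _ | a
    · obtain ⟨m, hm1, hm2⟩ := h3.toPos.slide hG h2
      rw [hG.e_right h4 hm1]
      exact hm2.swap.toMix.swap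
    · exact (ih rfl).e h4
  | s _ h4 ih => exact (ih ha).s h4

end MixPath

/-- A path of displacement `d` all of whose steps point into a single quadrant. -/
def Straight (E N : F → F → Prop) (f : F) (d : ℤ × ℤ) (g : F) : Prop :=
  ∃ a b : ℕ, (d = ((a : ℤ), (b : ℤ)) ∧ PosPath E N f a b g) ∨
    (d = (-(a : ℤ), -(b : ℤ)) ∧ PosPath E N g a b f) ∨
    (d = ((a : ℤ), -(b : ℤ)) ∧ MixPath E N f a b g) ∨
    (d = (-(a : ℤ), (b : ℤ)) ∧ MixPath E N g a b f)

namespace Straight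

theorem swap {f d g} (h : Straight E N f d g) : Straight N E f d.swap g := by
  obtain ⟨a, b, ⟨rfl, h⟩ | ⟨rfl, h⟩ | ⟨rfl, h⟩ | ⟨rfl, h⟩⟩ := h
  · exact ⟨b, a, Or.inl ⟨rfl, h.swap⟩⟩
  · exact ⟨b, a, Or.inr (Or.inl ⟨rfl, h.swap⟩)⟩
  · exact ⟨b, a, Or.inr (Or.inr (Or.inr ⟨rfl, h.swap⟩))⟩
  · exact ⟨b, a, Or.inr (Or.inr (Or.inl ⟨rfl, h.swap⟩))⟩

theorem reverse {f d g} (h : Straight E N f d g) :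
    Straight (fun a b => E b a) (fun a b => N b a) f (-d) g := by
  obtain ⟨a, b, ⟨rfl, h⟩ | ⟨rfl, h⟩ | ⟨rfl, h⟩ | ⟨rfl, h⟩⟩ := h
  · exact ⟨a, b, Or.inr (Or.inl ⟨by simp, h.reverse⟩)⟩
  · exact ⟨a, b, Or.inl ⟨by simp, h.reverse⟩⟩
  · exact ⟨a, b, Or.inr (Or.inr (Or.inr ⟨by simp, h.reverse⟩))⟩
  · exact ⟨a, b, Or.inr (Or.inr (Or.inl ⟨by simp, h.reverse⟩))⟩

theorem e (hG : GridSteps E N) {f d g h} (h1 : Straight E N f d g) (h2 : E g h) :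
    Straight E N f (d + (1, 0)) h := by
  obtain ⟨a, b, ⟨rfl, h1⟩ | ⟨rfl, h1⟩ | ⟨rfl, h1⟩ | ⟨rfl, h1⟩⟩ := h1
  · exact ⟨a + 1, b, Or.inl ⟨by simp, h1.e h2⟩⟩
  · rcases a with _ | a
    · exact ⟨1, b, Or.inr (Or.inr (Or.inl ⟨by simp, (h1.swap.toMix.swap).e h2⟩))⟩
    · obtain ⟨m, hm1, hm2⟩ := h1.first_e hG
      rw [hG.e_right h2 hm1]
      exact ⟨a, b, Or.inr (Or.inl ⟨by simp, hm2⟩)⟩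
  · exact ⟨a + 1, b, Or.inr (Or.inr (Or.inl ⟨by simp, h1.e h2⟩))⟩
  · rcases a with _ | a
    · exact ⟨1, b, Or.inl ⟨by simp, h1.toPos.e h2⟩⟩
    · exact ⟨a, b, Or.inr (Or.inr (Or.inr ⟨by simp, h1.cancel_e hG h2⟩))⟩

end Straight

namespace GridPath

theorem straight (hG : GridSteps E N) {f d g} (h : GridPath E N f d g) : Straight E N f d g := by
  induction h with
  | refl => exact ⟨0, 0, Or.inl ⟨rfl, .refl⟩⟩
  | e _ h ih => exact ih.e hG h
  | n _ h ih => exact (ih.swap.e hG.swap h).swap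
  | @w d _ _ _ h ih =>
    have := (ih.reverse.e hG.reverse h).reverse
    rwa [show -(-d + (1, 0)) = d - (1, 0) by abel] at this
  | @s d _ _ _ h ih =>
    have := (ih.reverse.swap.e hG.reverse.swap h).swap.reverse
    convert this using 1
    ext <;> simp [sub_eq_add_neg, add_comm]

theorem posPath (hG : GridSteps E N) {f d g} (h : GridPath E N f d g) (hd : 0 ≤ d) :
    ∃ a b : ℕ, d = ((a : ℤ), (b : ℤ)) ∧ PosPath E N f a b g := by
  replace h := h.straight hG
  obtain ⟨a, b, ⟨rfl, h⟩ | ⟨rfl, h⟩ | ⟨rfl, h⟩ | ⟨rfl, h⟩⟩ := h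
  · exact ⟨a, b, rfl, h⟩
  · obtain ⟨h1, h2⟩ := Prod.mk_le_mk.1 hd
    obtain rfl : a = 0 := by omega
    obtain rfl : b = 0 := by omega
    exact ⟨0, 0, rfl, h.eq_of_zero ▸ .refl⟩
  · obtain rfl : b = 0 := by
      have := (Prod.mk_le_mk.1 hd).2
      omega
    exact ⟨a, 0, rfl, h.swap.toPos.swap⟩
  · obtain rfl : a = 0 := by
      have := (Prod.mk_le_mk.1 hd).1
      omega
    exact ⟨0, b, rfl, h.toPos⟩

theorem trans {f d g d' h} (h1 : GridPath E N f d g) (h2 : GridPath E N g d' h) :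
    GridPath E N f (d + d') h := by
  induction h2 with
  | refl => simpa using h1
  | e _ h ih => simpa only [add_assoc] using ih.e h
  | n _ h ih => simpa only [add_assoc] using ih.n h
  | w _ h ih => simpa only [add_sub_assoc] using ih.w h
  | s _ h ih => simpa only [add_sub_assoc] using ih.s h

theorem symm {f d g} (h : GridPath E N f d g) : GridPath E N g (-d) f := by
  induction h with
  | refl => exact .refl
  | @e d _ _ _ h ih =>
    rw [show -(d + (1, 0)) = 0 - (1, 0) + -d by abel]
    exact (refl.w h).trans ih
  | @n d _ _ _ h ih =>
    rw [show -(d + (0, 1)) = 0 - (0, 1) + -d by abel]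
    exact (refl.s h).trans ih
  | @w d _ _ _ h ih =>
    rw [show -(d - (1, 0)) = 0 + (1, 0) + -d by abel]
    exact (refl.e h).trans ih
  | @s d _ _ _ h ih =>
    rw [show -(d - (0, 1)) = 0 + (0, 1) + -d by abel]
    exact (refl.n h).trans ih

end GridPath

/-- The displacements of closed paths at `f`. -/
def holonomy (E N : F → F → Prop) (f : F) : AddSubgroup (ℤ × ℤ) where
  carrier := {d | GridPath E N f d f}
  zero_mem' := .refl
  add_mem' := GridPath.trans
  neg_mem' := GridPath.symm

theorem holonomy_eq_zero (hG : GridSteps E N) {f : F} {d : ℤ × ℤ} (hd : d ∈ holonomy E N f)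
    (h0 : 0 ≤ d) : d = 0 := by
  obtain ⟨a, b, rfl, h⟩ := GridPath.posPath hG hd h0
  obtain ⟨rfl, rfl⟩ := h.eq_zero_of_cycle hG
  rfl

theorem holonomy_fst_eq_zero (hG : GridSteps E N) {f : F} {d : ℤ × ℤ}
    (hd : d ∈ holonomy E N f) (h0 : d.1 = 0) : d = 0 := by
  rcases le_total 0 d.2 with h | h
  · exact holonomy_eq_zero hG hd ⟨h0.ge, h⟩
  · have h1 : -d = 0 := holonomy_eq_zero hG (neg_mem hd) ⟨by simp [h0], by simpa using h⟩
    simpa using h1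

/-- The holonomy group is trivial or generated by a vector pointing north-west. -/
theorem holonomy_cases (hG : GridSteps E N) (f : F) :
    (∀ d ∈ holonomy E N f, d = 0) ∨ ∃ k l : ℕ, 0 < k ∧ 0 < l ∧
      (-(k : ℤ), (l : ℤ)) ∈ holonomy E N f ∧
      ∀ d ∈ holonomy E N f, ∃ t : ℤ, d = (-(t * k), t * l) := by
  by_cases htriv : ∀ d ∈ holonomy E N f, d = 0
  · exact Or.inl htriv
  push Not at htriv
  obtain ⟨d₀, hd₀, hne⟩ := htriv
  obtain ⟨c, hc⟩ := Int.subgroup_cyclic ((holonomy E N f).map (AddMonoidHom.fst ℤ ℤ))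
  have hmem : ∀ d ∈ holonomy E N f, ∃ t : ℤ, d.1 = t * c := by
    intro d hd
    have : d.1 ∈ (holonomy E N f).map (AddMonoidHom.fst ℤ ℤ) := ⟨d, hd, rfl⟩
    rw [hc, AddSubgroup.mem_closure_singleton] at this
    obtain ⟨t, ht⟩ := this
    exact ⟨t, by simpa using ht.symm⟩
  have hc0 : c ≠ 0 := by
    rintro rfl
    obtain ⟨t, ht⟩ := hmem d₀ hd₀
    exact hne (holonomy_fst_eq_zero hG hd₀ (by simpa using ht))
  obtain ⟨d, hd, hdc⟩ : c ∈ (holonomy E N f).map (AddMonoidHom.fst ℤ ℤ) := by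
    rw [hc]
    exact AddSubgroup.subset_closure rfl
  obtain ⟨e, he, heq⟩ : ∃ e ∈ holonomy E N f, e.1 = -(c.natAbs : ℤ) := by
    replace hdc : d.1 = c := hdc
    rcases le_total 0 c with h | h
    · exact ⟨-d, neg_mem hd, by rw [Prod.fst_neg]; omega⟩
    · exact ⟨d, hd, by omega⟩
  have he2 : 0 < e.2 := by
    by_contra hle
    have := holonomy_eq_zero hG (neg_mem he) ⟨by simp [heq], by simpa using hle⟩
    have h1 : e.1 = 0 := by simp [neg_eq_zero.1 this]
    omega
  refine Or.inr ⟨c.natAbs, e.2.toNat, by omega, by omega, ?_, fun v hv => ?_⟩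
  · rwa [show (-(c.natAbs : ℤ), (e.2.toNat : ℤ)) = e from
      Prod.ext heq.symm (Int.toNat_of_nonneg he2.le)]
  · obtain ⟨t, ht⟩ : ∃ t : ℤ, v.1 = t * c.natAbs := by
      obtain ⟨t, ht⟩ := hmem v hv
      rcases le_total 0 c with h | h
      · exact ⟨t, by rw [ht]; congr 1; omega⟩
      · exact ⟨-t, by rw [ht, neg_mul, ← mul_neg]; congr 1; omega⟩
    have h0 := holonomy_fst_eq_zero hG (add_mem hv (zsmul_mem he t)) (by simp [ht, heq])
    refine ⟨-t, ?_⟩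
    have h1 : v = -(t • e) := eq_neg_of_add_eq_zero_left h0
    rw [h1]
    ext
    · simp [heq]
    · have : (e.2.toNat : ℤ) = e.2 := by omega
      simp [this]

/-- The connected component of `f₀` develops onto a cylinder. -/
theorem exists_develop [Finite F] (hG : GridSteps E N) (f₀ : F) :
    ∃ (k l : ℕ) (H : F → ℤ × ℤ), 0 < k ∧ 0 < l ∧
      (∀ f g d, (∃ c, GridPath E N f₀ c f) → GridPath E N f d g →
        ∃ t : ℤ, d = H g - H f + (-(t * k), t * l)) ∧
      ∀ f g, (∃ c, GridPath E N f₀ c f) → (∃ c, GridPath E N f₀ c g) → ∀ t : ℤ,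
        0 ≤ H g - H f + (-(t * k), t * l) → GridPath E N f (H g - H f + (-(t * k), t * l)) g := by
  classical
  let H : F → ℤ × ℤ := fun f => if h : ∃ c, GridPath E N f₀ c f then h.choose else 0
  have hH : ∀ f, (∃ c, GridPath E N f₀ c f) → GridPath E N f₀ (H f) f := by
    intro f h
    simp only [H, h, dite_true]
    exact h.choose_spec
  have hol : ∀ f g d, (∃ c, GridPath E N f₀ c f) → GridPath E N f d g →
      H f + d - H g ∈ holonomy E N f₀ := by
    intro f g d hf hd
    have h1 := (hH f hf).trans hd
    have h2 := h1.trans (hH g ⟨_, h1⟩).symm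
    rwa [← sub_eq_add_neg] at h2
  have base : ∀ f g, (∃ c, GridPath E N f₀ c f) → (∃ c, GridPath E N f₀ c g) →
      ∀ c ∈ holonomy E N f₀, GridPath E N f (H g - H f + c) g := by
    intro f g hf hg c hc
    have := ((hH f hf).symm.trans hc).trans (hH g hg)
    rwa [show -H f + c + H g = H g - H f + c by abel] at this
  rcases holonomy_cases hG f₀ with htriv | ⟨k, l, hk, hl, hkl, hgen⟩
  · obtain ⟨M, hM⟩ : ∃ M : ℕ, ∀ f, (H f).1.natAbs ≤ M ∧ (H f).2.natAbs ≤ M := by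
      obtain ⟨M₁, h₁⟩ := (Set.finite_range fun f => (H f).1.natAbs).bddAbove
      obtain ⟨M₂, h₂⟩ := (Set.finite_range fun f => (H f).2.natAbs).bddAbove
      exact ⟨max M₁ M₂, fun f => ⟨(h₁ ⟨f, rfl⟩).trans (le_max_left _ _),
        (h₂ ⟨f, rfl⟩).trans (le_max_right _ _)⟩⟩
    refine ⟨2 * M + 1, 2 * M + 1, H, by omega, by omega, fun f g d hf hd => ⟨0, ?_⟩,
      fun f g hf hg t ht => ?_⟩
    · have := htriv _ (hol f g d hf hd)
      rw [sub_eq_zero] at this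
      simp [← this]
    · obtain rfl : t = 0 := by
        have h1 : 0 ≤ (H g).1 - (H f).1 + -(t * (2 * M + 1)) := by simpa using ht.1
        have h2 : 0 ≤ (H g).2 - (H f).2 + t * (2 * M + 1) := by simpa using ht.2
        have hg := hM g
        have hf := hM f
        by_contra hne
        rcases lt_or_gt_of_ne hne with h | h
        · have : t * (2 * M + 1) ≤ -1 * (2 * M + 1) :=
            mul_le_mul_of_nonneg_right (by omega) (by omega)
          omega
        · have : 1 * (2 * M + 1) ≤ t * (2 * M + 1) :=
            mul_le_mul_of_nonneg_right (by omega) (by omega)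
          omega
      exact base f g hf hg _ (by
        convert (holonomy E N f₀).zero_mem using 1
        simp)
  · refine ⟨k, l, H, hk, hl, fun f g d hf hd => ?_, fun f g hf hg t _ => ?_⟩
    · obtain ⟨t, ht⟩ := hgen _ (hol f g d hf hd)
      refine ⟨t, ?_⟩
      rw [← ht]
      abel
    · refine base f g hf hg _ ?_
      have := zsmul_mem hkl t
      simpa using this

end Grid

section Fibers

variable {P : Type*} [PartialOrder P] {R B : P → P → Prop}

theorem SameFiber.symm {p q : P} (h : SameFiber R B p q) : SameFiber R B q p :=
  Or.symm h

theorem SameFiber.le_of_covBy [Finite P] (hR : ChainRel R) (hB : ChainRel B)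
    (hcov : ∀ x y : P, x ⋖ y → R x y ∨ B x y) {p q v : P} (hpq : p ⋖ q)
    (hne : ¬SameFiber R B p q) (hv : SameFiber R B p v) : v ≤ p := by
  rcases hv.comparable with h | h
  · rcases h.eq_or_lt with rfl | h
    · exact le_rfl
    · rcases (hv.le_of_le hR hB hcov hne hpq.le).eq_or_lt with rfl | h1
      · exact absurd hv hne
      · exact absurd h1 (hpq.2 h)
  · exact h

theorem SameFiber.ge_of_covBy [Finite P] (hR : ChainRel R) (hB : ChainRel B)
    (hcov : ∀ x y : P, x ⋖ y → R x y ∨ B x y) {p q v : P} (hpq : p ⋖ q)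
    (hne : ¬SameFiber R B p q) (hv : SameFiber R B q v) : q ≤ v := by
  rcases hv.comparable with h | h
  · exact h
  · rcases h.eq_or_lt with rfl | h
    · exact le_rfl
    · rcases (hv.ge_of_ge hR hB hcov (fun h => hne h.symm) hpq.le).eq_or_lt with rfl | h1
      · exact absurd hv.symm hne
      · exact absurd h (hpq.2 h1)

/-- In a square of fibers `w`, `x`, `y`, `z`, the fiber of the minimum is at most as large as
the fiber of `y`. -/
theorem ncard_fiber_le [Finite P] (hR : ChainRel R) (hB : ChainRel B) (hp : PushUp R B)
    (hcov : ∀ x y : P, x ⋖ y → R x y ∨ B x y) {w x y₁ y z : P}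
    (hwx : w ⋖ x) (h1 : R w x) (h2 : ¬B w x) (hwy : w ⋖ y₁) (h3 : B w y₁) (h4 : ¬R w y₁)
    (hyy : SameFiber R B y₁ y) (hyz : y ⋖ z) (h5 : R y z) (h6 : ¬B y z) (hxz : B x z)
    (hle : x ≤ z) :
    {v | SameFiber R B w v}.ncard ≤ {v | SameFiber R B y v}.ncard := by
  have eqv := SameFiber.equivalence hR hB hcov
  have nwx : ¬SameFiber R B w x := fun h => h2 (h.rel hR hB).2
  have nwy : ¬SameFiber R B w y₁ := fun h => h4 (h.rel hR hB).1
  have nyz : ¬SameFiber R B y z := fun h => h6 (h.rel hR hB).2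
  have hy₁y : y₁ ≤ y := hyy.ge_of_covBy hR hB hcov hwy nwy
  have hDI : DoubleInterval R B y₁ y := by
    rcases hyy with h | h
    · exact h
    · obtain rfl := le_antisymm hy₁y h.1
      exact h
  by_contra hlt
  push Not at hlt
  let U : Set P := {v | ∃ u, R u v ∧ u ≤ v ∧ (SameFiber R B w u ∨ (B w u ∧ y < u))}
  have hU := hp U (by
    rintro p q hpq hle ⟨u, h7, h8, h9⟩
    exact ⟨u, hR.trans h7 hpq, h8.trans hle, h9⟩) w x h1 hwx.le (by
    have s1 : {v | B w v ∧ w ≤ v} ⊆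
        insert w ({v | SameFiber R B y v} ∪ {v | B w v ∧ y < v}) := by
      rintro v ⟨hv1, hv2⟩
      rcases hv2.eq_or_lt with rfl | hv2
      · exact Or.inl rfl
      have hv3 := hB.cover_le hwy h3 hv1 hv2
      rcases hB.total (hB.trans (hB.symm hv1) (hB.trans h3 (hyy.rel hR hB).2)) with h | h
      · exact Or.inr (Or.inl (Or.inr (hDI.right hR hB hv3 h)))
      · rcases h.eq_or_lt with rfl | h
        · exact Or.inr (Or.inl (eqv.refl _))
        · exact Or.inr (Or.inr ⟨hv1, h⟩)
    have s2 : {v | SameFiber R B w v} ∪ {v | B w v ∧ y < v} ⊆ {v | B w v ∧ v ∈ U} := by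
      rintro v (hv | hv)
      · exact ⟨(hv.rel hR hB).2, v, hR.refl v, le_rfl, Or.inl hv⟩
      · exact ⟨hv.1, v, hR.refl v, le_rfl, Or.inr hv⟩
    have hd : Disjoint {v | SameFiber R B w v} {v | B w v ∧ y < v} :=
      Set.disjoint_left.2 fun v hv hv' => absurd
        (hwy.lt.trans_le (hy₁y.trans hv'.2.le)) (not_lt_of_ge (hv.le_of_covBy hR hB hcov hwx nwx))
    have c1 := Set.ncard_le_ncard s1 (Set.toFinite _)
    have c2 := Set.ncard_le_ncard s2 (Set.toFinite _)
    rw [Set.ncard_union_eq hd (Set.toFinite _) (Set.toFinite _)] at c2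
    have c3 := Set.ncard_insert_le w ({v | SameFiber R B y v} ∪ {v | B w v ∧ y < v})
    have c4 := Set.ncard_union_le {v | SameFiber R B y v} {v | B w v ∧ y < v}
    omega)
  refine absurd hU (not_le_of_gt ?_)
  refine Set.ncard_lt_ncard (Set.ssubset_iff_exists.2 ⟨?_, z, ⟨hxz, hle⟩, ?_⟩) (Set.toFinite _)
  · rintro v ⟨hv, u, h7, h8, h9⟩
    refine ⟨hv, ?_⟩
    rcases hB.total hv with h | h
    · exact h
    rcases h.eq_or_lt with rfl | h
    · exact le_rfl
    exfalso
    rcases h9 with h9 | ⟨h9, h10⟩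
    · have hwv : R w v := hR.trans (h9.rel hR hB).1 h7
      rcases hR.total hwv with h10 | h10
      · rcases h10.eq_or_lt with rfl | h10
        · exact h2 (hB.symm hv)
        · exact hwx.2 h10 h
      · have hu := h9.le_of_covBy hR hB hcov hwx nwx
        have hDu : DoubleInterval R B u w := by
          rcases h9 with h9 | h9
          · obtain rfl := le_antisymm hu h9.1
            exact h9
          · exact h9
        exact h2 (hB.trans (hDu.right hR hB h8 h10 |>.rel.2 |> hB.symm) (hB.symm hv))
    · exact hwx.2 ((hwy.lt.trans_le hy₁y).trans h10) (h8.trans_lt h)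
  · rintro ⟨-, u, h7, h8, h9 | ⟨h9, h10⟩⟩
    · exact h4 (hR.trans (hR.trans (h9.rel hR hB).1 h7)
        (hR.symm (hR.trans (hyy.rel hR hB).1 h5)))
    · rcases h8.eq_or_lt with rfl | h8
      · exact h2 (hB.trans h9 (hB.symm hxz))
      · exact hyz.2 h10 h8

end Fibers

section FiberSteps

variable {P : Type*} [PartialOrder P] {R B : P → P → Prop}

/-- The step relation on classes of `s` induced by covering relations of `P` that lie on a
chain of `R` but not on a chain of `B`. -/
def StepOf (s : Setoid P) (R B : P → P → Prop) (a b : Quotient s) : Prop :=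
  ∃ p q, Quotient.mk s p = a ∧ Quotient.mk s q = b ∧ p ⋖ q ∧ R p q ∧ ¬B p q

namespace StepOf

variable {s : Setoid P}

theorem right_unique [Finite P] (hR : ChainRel R) (hB : ChainRel B)
    (hcov : ∀ x y : P, x ⋖ y → R x y ∨ B x y) (hs : ∀ p q, s p q ↔ SameFiber R B p q)
    {a b c : Quotient s} (h1 : StepOf s R B a b) (h2 : StepOf s R B a c) : b = c := by
  obtain ⟨p, q, rfl, rfl, h3, h4, h5⟩ := h1
  obtain ⟨p', q', h, rfl, h3', h4', h5'⟩ := h2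
  have hpp : SameFiber R B p' p := (hs _ _).1 (Quotient.exact h)
  obtain rfl := le_antisymm
    (hpp.le_of_covBy hR hB hcov h3' fun h => h5' (h.rel hR hB).2)
    (hpp.symm.le_of_covBy hR hB hcov h3 fun h => h5 (h.rel hR hB).2)
  rw [hR.cover_unique h3 h4 h3' h4']

theorem left_unique [Finite P] (hR : ChainRel R) (hB : ChainRel B)
    (hcov : ∀ x y : P, x ⋖ y → R x y ∨ B x y) (hs : ∀ p q, s p q ↔ SameFiber R B p q)
    {a b c : Quotient s} (h1 : StepOf s R B a c) (h2 : StepOf s R B b c) : a = b := by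
  obtain ⟨p, q, rfl, rfl, h3, h4, h5⟩ := h1
  obtain ⟨p', q', rfl, h, h3', h4', h5'⟩ := h2
  have hqq : SameFiber R B q' q := (hs _ _).1 (Quotient.exact h)
  obtain rfl := le_antisymm
    (hqq.ge_of_covBy hR hB hcov h3' fun h => h5' (h.rel hR hB).2)
    (hqq.symm.ge_of_covBy hR hB hcov h3 fun h => h5 (h.rel hR hB).2)
  rcases hR.total (hR.trans h4 (hR.symm h4')) with h | h
  · rcases h.eq_or_lt with rfl | h
    · rfl
    · exact absurd h3'.lt (h3.2 h)
  · rcases h.eq_or_lt with rfl | h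
    · rfl
    · exact absurd h3.lt (h3'.2 h)

theorem lt [Finite P] (hR : ChainRel R) (hB : ChainRel B)
    (hcov : ∀ x y : P, x ⋖ y → R x y ∨ B x y) (hs : ∀ p q, s p q ↔ SameFiber R B p q) {p q : P}
    (h : StepOf s R B (Quotient.mk s p) (Quotient.mk s q)) : p < q := by
  obtain ⟨p', q', h1, h2, h3, h4, h5⟩ := h
  have hne : ¬SameFiber R B p' q' := fun h => h5 (h.rel hR hB).2
  have e1 : SameFiber R B p' p := (hs _ _).1 (Quotient.exact h1)
  have e2 : SameFiber R B q' q := (hs _ _).1 (Quotient.exact h2)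
  exact (e1.le_of_covBy hR hB hcov h3 hne).trans_lt
    (h3.lt.trans_le (e2.ge_of_covBy hR hB hcov h3 hne))

theorem square [Finite P] (hR : ChainRel R) (hB : ChainRel B) (hp : PushUp R B)
    (hp' : PushUp B R) (hcov : ∀ x y : P, x ⋖ y → R x y ∨ B x y)
    (hs : ∀ p q, s p q ↔ SameFiber R B p q) {f g h : Quotient s}
    (h1 : StepOf s R B f g) (h2 : StepOf s B R g h) :
    ∃ m, StepOf s B R f m ∧ StepOf s R B m h := by
  obtain ⟨p, q, rfl, rfl, h3, h4, h5⟩ := h1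
  obtain ⟨q', r, h, rfl, h6, h7, h8⟩ := h2
  obtain ⟨a, b, k1, k2, k3, k4, k5, k6, k7⟩ := exists_square hR hB hp hp' hcov h3 h4 h5
    ((hs _ _).1 (Quotient.exact h)).symm h6 h7 h8
  exact ⟨Quotient.mk s a, ⟨p, a, rfl, rfl, k1, k2, k3⟩,
    ⟨b, r, Quotient.sound ((hs _ _).2 k4.symm), rfl, k5, k6, k7⟩⟩

theorem transGen_lt [Finite P] (hR : ChainRel R) (hB : ChainRel B)
    (hcov : ∀ x y : P, x ⋖ y → R x y ∨ B x y) (hs : ∀ p q, s p q ↔ SameFiber R B p q) {p q : P}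
    (h : Relation.TransGen (fun a b => StepOf s R B a b ∨ StepOf s B R a b)
      (Quotient.mk s p) (Quotient.mk s q)) : p < q := by
  have step : ∀ p q : P, (StepOf s R B (Quotient.mk s p) (Quotient.mk s q) ∨
      StepOf s B R (Quotient.mk s p) (Quotient.mk s q)) → p < q := by
    rintro p q (h | h)
    · exact h.lt hR hB hcov hs
    · exact h.lt hB hR (fun x y h => (hcov x y h).symm)
        (fun p q => (hs p q).trans ⟨.swap, .swap⟩)
  generalize hb : Quotient.mk s q = b at h
  induction h generalizing q with
  | single h => exact step p q (hb ▸ h)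
  | @tail b c _ h2 ih =>
    obtain ⟨b', rfl⟩ := Quotient.exists_rep b
    exact (ih rfl).trans (step b' q (hb ▸ h2))

theorem gridSteps [Finite P] (hR : ChainRel R) (hB : ChainRel B) (hp : PushUp R B)
    (hp' : PushUp B R) (hcov : ∀ x y : P, x ⋖ y → R x y ∨ B x y)
    (hs : ∀ p q, s p q ↔ SameFiber R B p q) : GridSteps (StepOf s R B) (StepOf s B R) := by
  have hcov' : ∀ x y : P, x ⋖ y → B x y ∨ R x y := fun x y h => (hcov x y h).symm
  have hs' : ∀ p q, s p q ↔ SameFiber B R p q := fun p q => (hs p q).trans ⟨.swap, .swap⟩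
  exact {
    e_right := right_unique hR hB hcov hs
    e_left := left_unique hR hB hcov hs
    n_right := right_unique hB hR hcov' hs'
    n_left := left_unique hB hR hcov' hs'
    en := square hR hB hp hp' hcov hs
    ne := square hB hR hp' hp hcov' hs'
    acyclic := fun f h => by
      obtain ⟨p, rfl⟩ := Quotient.exists_rep f
      exact lt_irrefl p (transGen_lt hR hB hcov hs h) }

theorem exists_posPath_of_le [Finite P] (hR : ChainRel R) (hB : ChainRel B)
    (hcov : ∀ x y : P, x ⋖ y → R x y ∨ B x y) (hs : ∀ p q, s p q ↔ SameFiber R B p q) {p q : P}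
    (h : p ≤ q) : ∃ a b, PosPath (StepOf s R B) (StepOf s B R)
      (Quotient.mk s p) a b (Quotient.mk s q) := by
  classical
  have := Fintype.ofFinite P
  have := Fintype.toLocallyFiniteOrder (α := P)
  induction le_iff_reflTransGen_covBy.1 h with
  | refl => exact ⟨0, 0, .refl⟩
  | @tail b c h1 h2 ih =>
    obtain ⟨m, n, hmn⟩ := ih (le_iff_reflTransGen_covBy.2 h1)
    by_cases hRr : R b c
    · by_cases hBr : B b c
      · have e : Quotient.mk s b = Quotient.mk s c := by
          refine Quotient.sound ((hs _ _).2 (Or.inl ⟨h2.le, fun v hv1 hv2 => ?_⟩))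
          rcases h2.eq_or_eq hv1 hv2 with rfl | rfl
          · exact ⟨hR.refl _, hB.refl _⟩
          · exact ⟨hRr, hBr⟩
        exact ⟨m, n, e ▸ hmn⟩
      · exact ⟨m + 1, n, hmn.e ⟨b, c, rfl, rfl, h2, hRr, hBr⟩⟩
    · exact ⟨m, n + 1, hmn.n ⟨b, c, rfl, rfl, h2, (hcov b c h2).resolve_left hRr, hRr⟩⟩

theorem le_of_posPath [Finite P] (hR : ChainRel R) (hB : ChainRel B)
    (hcov : ∀ x y : P, x ⋖ y → R x y ∨ B x y) (hs : ∀ p q, s p q ↔ SameFiber R B p q) {p q : P}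
    {a b : ℕ} (h : PosPath (StepOf s R B) (StepOf s B R)
      (Quotient.mk s p) a b (Quotient.mk s q)) (hne : ¬SameFiber R B p q) : p < q := by
  rcases Relation.reflTransGen_iff_eq_or_transGen.1 h.reflTransGen with h | h
  · exact absurd ((hs _ _).1 (Quotient.exact h.symm)) hne
  · exact transGen_lt hR hB hcov hs h

theorem exists_gridPath_of_mem_connComp [Finite P] (hR : ChainRel R) (hB : ChainRel B)
    (hcov : ∀ x y : P, x ⋖ y → R x y ∨ B x y) (hs : ∀ p q, s p q ↔ SameFiber R B p q) {p q : P}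
    (h : q ∈ ConnComp P p) : ∃ c, GridPath (StepOf s R B) (StepOf s B R)
      (Quotient.mk s p) c (Quotient.mk s q) := by
  induction h with
  | refl => exact ⟨0, .refl⟩
  | @tail b c _ h ih =>
    obtain ⟨d, hd⟩ := ih
    rcases h with h | h
    · obtain ⟨m, n, hmn⟩ := exists_posPath_of_le hR hB hcov hs h
      exact ⟨_, hd.trans hmn.gridPath⟩
    · obtain ⟨m, n, hmn⟩ := exists_posPath_of_le hR hB hcov hs h
      exact ⟨_, hd.trans hmn.gridPath.symm⟩

end StepOf

end FiberSteps

section Cylinder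

variable {k n : ℕ}

theorem CylRel.refl (p : ℤ × ℤ) : CylRel k n p p := ⟨0, by simp⟩

theorem CylRel.symm {p q : ℤ × ℤ} (h : CylRel k n p q) : CylRel k n q p := by
  obtain ⟨t, h1, h2⟩ := h
  exact ⟨-t, by rw [h1]; ring, by rw [h2]; ring⟩

theorem CylRel.trans {p q r : ℤ × ℤ} (h : CylRel k n p q) (h' : CylRel k n q r) :
    CylRel k n p r := by
  obtain ⟨t, h1, h2⟩ := h
  obtain ⟨u, h3, h4⟩ := h'
  exact ⟨t + u, by rw [h3, h1]; ring, by rw [h4, h2]; ring⟩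

theorem cylLe_iff {p q : ℤ × ℤ} :
    CylLe k n p q ↔ ∃ t : ℤ, p.1 ≤ q.1 - t * k ∧ p.2 ≤ q.2 + t * ((n : ℤ) - k) := by
  constructor
  · rintro ⟨p', q', ⟨t, h1, h2⟩, ⟨u, h3, h4⟩, h5, h6⟩
    exact ⟨u - t, by linarith, by linarith⟩
  · rintro ⟨t, h1, h2⟩
    exact ⟨p, (q.1 - t * k, q.2 + t * ((n : ℤ) - k)), .refl p, ⟨t, rfl, rfl⟩, h1, h2⟩

theorem CylLe.trans {p q r : ℤ × ℤ} (h : CylLe k n p q) (h' : CylLe k n q r) :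
    CylLe k n p r := by
  rw [cylLe_iff] at *
  obtain ⟨t, h1, h2⟩ := h
  obtain ⟨u, h3, h4⟩ := h'
  exact ⟨t + u, by linarith, by linarith⟩

theorem CylRel.cylLe {p q : ℤ × ℤ} (h : CylRel k n p q) : CylLe k n p q :=
  ⟨q, q, h, .refl q, le_rfl, le_rfl⟩

end Cylinder

theorem mem_connComp_of_comparable {P : Type*} [PartialOrder P] {x p q : P}
    (hp : p ∈ ConnComp P x) (h : p ≤ q ∨ q ≤ p) : q ∈ ConnComp P x :=
  Relation.ReflTransGen.tail hp h

theorem covBy_int_prod {p q : ℤ × ℤ} (h : p ⋖ q) : q = p + (1, 0) ∨ q = p + (0, 1) := by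
  obtain ⟨p1, p2⟩ := p
  obtain ⟨q1, q2⟩ := q
  rw [Prod.mk_covBy_mk_iff, Order.covBy_iff_add_one_eq, Order.covBy_iff_add_one_eq] at h
  rcases h with ⟨h1, rfl⟩ | ⟨h1, rfl⟩ <;> simp [h1]

theorem PosPath.step_e {F : Type*} {E N : F → F → Prop} (hG : GridSteps E N) {f g : F}
    (h : PosPath E N f 1 0 g) : E f g := by
  obtain ⟨m, h1, h2⟩ := first_e hG (a := 0) h
  exact h2.eq_of_zero ▸ h1

section Forward

variable {P : Type*} [PartialOrder P] {R B : P → P → Prop} {s : Setoid P}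

theorem StepOf.dual (hR : ChainRel R) (hB : ChainRel B) {a b : Quotient s}
    (h : StepOf s R B a b) : @StepOf Pᵒᵈ _ s R B b a := by
  obtain ⟨p, q, rfl, rfl, h1, h2, h3⟩ := h
  exact ⟨q, p, rfl, rfl, h1.toDual, hR.symm h2, fun h => h3 (hB.symm h)⟩

theorem StepOf.ncard_fiber_le [Finite P] (hR : ChainRel R) (hB : ChainRel B) (hp : PushUp R B)
    (hcov : ∀ x y : P, x ⋖ y → R x y ∨ B x y) (hs : ∀ p q, s p q ↔ SameFiber R B p q)
    {w x y z : P} (hwx : StepOf s R B (Quotient.mk s w) (Quotient.mk s x))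
    (hwy : StepOf s B R (Quotient.mk s w) (Quotient.mk s y))
    (hyz : StepOf s R B (Quotient.mk s y) (Quotient.mk s z))
    (hxz : StepOf s B R (Quotient.mk s x) (Quotient.mk s z)) :
    {v | SameFiber R B w v}.ncard ≤ {v | SameFiber R B y v}.ncard := by
  have hcov' : ∀ x y : P, x ⋖ y → B x y ∨ R x y := fun x y h => (hcov x y h).symm
  have hs' : ∀ p q, s p q ↔ SameFiber B R p q := fun p q => (hs p q).trans ⟨.swap, .swap⟩
  have eqv := SameFiber.equivalence hR hB hcov
  have same : ∀ {p q}, Quotient.mk s p = Quotient.mk s q → SameFiber R B p q :=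
    fun h => (hs _ _).1 (Quotient.exact h)
  have hlt := hxz.lt hB hR hcov' hs'
  obtain ⟨w', x', ew, ex, h1, h2, h3⟩ := hwx
  obtain ⟨w₁, y₁, ew₁, ey₁, h4, h5, h6⟩ := hwy
  obtain ⟨y', z', ey, ez, h7, h8, h9⟩ := hyz
  obtain ⟨x₂, z₂, ex₂, ez₂, h10, h11, h12⟩ := hxz
  have hww : SameFiber R B w₁ w' := same (ew₁.trans ew.symm)
  obtain rfl : w' = w₁ := le_antisymm
    (hww.le_of_covBy hR hB hcov h4 fun h => h6 (h.rel hR hB).1)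
    (hww.symm.le_of_covBy hR hB hcov h1 fun h => h3 (h.rel hR hB).2)
  have hxz' : x' ≤ z' := by
    refine le_of_lt (StepOf.lt hB hR hcov' hs' ?_)
    rw [ex, ez]
    exact ⟨x₂, z₂, ex₂, ez₂, h10, h11, h12⟩
  have hBxz : B x' z' := hB.trans (hB.trans ((same (ex.trans ex₂.symm)).rel hR hB).2 h11)
    ((same (ez₂.trans ez.symm)).rel hR hB).2
  have key := _root_.ncard_fiber_le hR hB hp hcov h1 h2 h3 h4 h5 h6 (same (ey₁.trans ey.symm))
    h7 h8 h9 hBxz hxz'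
  have congr : ∀ {p q}, Quotient.mk s p = Quotient.mk s q →
      {v | SameFiber R B p v} = {v | SameFiber R B q v} := fun h =>
    Set.ext fun v => ⟨eqv.trans (eqv.symm (same h)), eqv.trans (same h)⟩
  rwa [congr ew, congr ey] at key

theorem StepOf.max_ncard_fiber_le [Finite P] (hR : ChainRel R) (hB : ChainRel B)
    (hp : PushUp R B) (hp' : PushUp B R)
    (hcov : ∀ x y : P, x ⋖ y → R x y ∨ B x y) (hs : ∀ p q, s p q ↔ SameFiber R B p q)
    {w x y z : P} (hwx : StepOf s R B (Quotient.mk s w) (Quotient.mk s x))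
    (hwy : StepOf s B R (Quotient.mk s w) (Quotient.mk s y))
    (hyz : StepOf s R B (Quotient.mk s y) (Quotient.mk s z))
    (hxz : StepOf s B R (Quotient.mk s x) (Quotient.mk s z)) :
    max {v | SameFiber R B w v}.ncard {v | SameFiber R B z v}.ncard ≤
      min {v | SameFiber R B x v}.ncard {v | SameFiber R B y v}.ncard := by
  have hcov' : ∀ x y : P, x ⋖ y → B x y ∨ R x y := fun x y h => (hcov x y h).symm
  have hs' : ∀ p q, s p q ↔ SameFiber B R p q := fun p q => (hs p q).trans ⟨.swap, .swap⟩
  have flip : ∀ p, {v | SameFiber B R p v} = {v | SameFiber R B p v} := fun p =>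
    Set.ext fun v => ⟨.swap, .swap⟩
  have a1 := StepOf.ncard_fiber_le hR hB hp hcov hs hwx hwy hyz hxz
  have a2 := StepOf.ncard_fiber_le hB hR hp' hcov' hs' hwy hwx hxz hyz
  have dcov : ∀ x y : Pᵒᵈ, x ⋖ y → R x y ∨ B x y := fun x y hxy =>
    (hcov y x hxy.ofDual).imp hR.symm hB.symm
  have dcard : ∀ p : P, Set.ncard (α := Pᵒᵈ) {v | @SameFiber Pᵒᵈ _ R B p v} =
      {v | SameFiber R B p v}.ncard := fun p => congrArg (Set.ncard (α := P))
    (Set.ext fun v => ⟨fun h => @SameFiber.dual Pᵒᵈ _ R B hR.dual hB.dual p v h,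
      fun h => h.dual hR hB⟩)
  have ds : ∀ p q, s p q ↔ @SameFiber Pᵒᵈ _ R B p q := fun p q =>
    (hs p q).trans ⟨fun h => h.dual hR hB,
      fun h => @SameFiber.dual Pᵒᵈ _ R B hR.dual hB.dual p q h⟩
  have a3 := @StepOf.ncard_fiber_le Pᵒᵈ _ R B s _ hR.dual hB.dual (hp.dual hR hB) dcov ds
    z y x w (hyz.dual hR hB) (hxz.dual hB hR) (hwx.dual hR hB) (hwy.dual hB hR)
  have a4 := @StepOf.ncard_fiber_le Pᵒᵈ _ B R s _ hB.dual hR.dual (hp'.dual hB hR)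
    (fun x y h => (dcov x y h).symm) (fun p q => (ds p q).trans ⟨.swap, .swap⟩)
    z x y w (hxz.dual hB hR) (hyz.dual hR hB) (hwy.dual hB hR) (hwx.dual hR hB)
  have dcard' : ∀ p : P, Set.ncard (α := Pᵒᵈ) {v | @SameFiber Pᵒᵈ _ B R p v} =
      {v | SameFiber R B p v}.ncard := fun p =>
    (congrArg (Set.ncard (α := Pᵒᵈ)) (Set.ext fun v => ⟨.swap, .swap⟩)).trans (dcard p)
  rw [flip, flip] at a2
  exact max_le (le_min a2 a1) (le_min ((dcard z).ge.trans (a3.trans (dcard x).le))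
    ((dcard' z).ge.trans (a4.trans (dcard' y).le)))

/-- Every component of a poset in `N₂` reduces to a convex subposet of a cylinder poset. -/
theorem exists_cylReduction [Finite P] (hP : InN2 P) (x₀ : P) :
    ∃ k n : ℕ, 0 < k ∧ k < n ∧
      ∃ h : ↥(ConnComp P x₀) → ℤ × ℤ, IsCylReduction k n h ∧ TechCondition k n h := by
  obtain ⟨R, B, hR, hB, hp, hp', hcov⟩ := inN2_iff.1 hP
  have eqv := SameFiber.equivalence hR hB hcov
  let s : Setoid P := ⟨SameFiber R B, eqv⟩
  have hs : ∀ p q, s p q ↔ SameFiber R B p q := fun _ _ => Iff.rfl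
  have hG := StepOf.gridSteps hR hB hp hp' hcov hs
  obtain ⟨k, l, H, hk, hl, hH1, hH2⟩ := exists_develop hG (Quotient.mk s x₀)
  have hl' : ((k + l : ℕ) : ℤ) - k = l := by push_cast; ring
  have hmem : ∀ p : ConnComp P x₀, ∃ c, GridPath (StepOf s R B) (StepOf s B R)
      (Quotient.mk s x₀) c (Quotient.mk s p.1) := fun p =>
    StepOf.exists_gridPath_of_mem_connComp hR hB hcov hs p.2
  let h : ConnComp P x₀ → ℤ × ℤ := fun p => H (Quotient.mk s p.1)
  have path : ∀ (p q : ConnComp P x₀) (a b : ℕ) (u v : ℤ × ℤ), CylRel k (k + l) (h p) u →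
      CylRel k (k + l) (h q) v → v = u + ((a : ℤ), (b : ℤ)) →
      PosPath (StepOf s R B) (StepOf s B R) (Quotient.mk s p.1) a b (Quotient.mk s q.1) := by
    rintro p q a b u v ⟨t, h1, h2⟩ ⟨t', h3, h4⟩ rfl
    rw [hl'] at h2 h4
    have e : H (Quotient.mk s q.1) - H (Quotient.mk s p.1) + (-((t' - t) * k), (t' - t) * l) =
        ((a : ℤ), (b : ℤ)) := by
      ext
      · simp only [Prod.fst_add, Prod.fst_sub] at h1 h3 ⊢
        linarith
      · simp only [Prod.snd_add, Prod.snd_sub] at h2 h4 ⊢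
        linarith
    have g := hH2 _ _ (hmem p) (hmem q) (t' - t) (by rw [e]; exact ⟨by simp, by simp⟩)
    rw [e] at g
    obtain ⟨a', b', e', g'⟩ := g.posPath hG ⟨by simp, by simp⟩
    rw [Prod.mk.injEq, Nat.cast_inj, Nat.cast_inj] at e'
    rwa [e'.1, e'.2]
  have disp : ∀ (p q : ConnComp P x₀) (a b : ℕ),
      PosPath (StepOf s R B) (StepOf s B R) (Quotient.mk s p.1) a b (Quotient.mk s q.1) →
      CylRel k (k + l) (h q) (h p + ((a : ℤ), (b : ℤ))) := by
    intro p q a b g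
    obtain ⟨t, ht⟩ := hH1 _ _ _ (hmem p) g.gridPath
    refine ⟨t, ?_, ?_⟩
    · rw [ht]
      simp only [h, Prod.fst_add, Prod.fst_sub]
      ring
    · rw [ht, hl']
      simp only [h, Prod.snd_add, Prod.snd_sub]
      ring
  have rel_iff : ∀ p q : ConnComp P x₀, CylRel k (k + l) (h p) (h q) ↔ SameFiber R B p.1 q.1 := by
    intro p q
    constructor
    · intro hpq
      have := path p q 0 0 (h q) (h q) hpq (.refl _) (by simp)
      exact (hs _ _).1 (Quotient.exact this.eq_of_zero)
    · intro hpq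
      have : h p = h q := congrArg H (Quotient.sound hpq)
      rw [this]
      exact .refl _
  have nonneg : ∀ u v : ℤ × ℤ, u.1 ≤ v.1 → u.2 ≤ v.2 → ∃ a b : ℕ,
      v = u + ((a : ℤ), (b : ℤ)) := fun u v h1 h2 =>
    ⟨(v.1 - u.1).toNat, (v.2 - u.2).toNat, by ext <;> simp <;> omega⟩
  refine ⟨k, k + l, hk, by omega, h, ⟨?_, ?_, ?_⟩, ?_⟩
  · intro z p hpz q hqz _
    exact ((rel_iff p q).1 (hpz.trans hqz.symm)).comparable
  · intro p q hpq
    constructor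
    · intro hle
      obtain ⟨a, b, g⟩ := StepOf.exists_posPath_of_le hR hB hcov hs (show p.1 ≤ q.1 from hle)
      exact ⟨h p, _, .refl _, disp p q a b g, by simp, by simp⟩
    · rintro ⟨p', q', h1, h2, h3, h4⟩
      obtain ⟨a, b, e⟩ := nonneg p' q' h3 h4
      exact (StepOf.le_of_posPath hR hB hcov hs (path p q a b p' q' h1 h2 e)
        fun h => hpq ((rel_iff p q).2 h)).le
  · rintro p q z ⟨p', z', h1, h2, h3, h4⟩ hzq
    obtain ⟨t, h5, h6⟩ := cylLe_iff.1 (h2.symm.cylLe.trans hzq)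
    obtain ⟨a, b, e⟩ := nonneg p' z' h3 h4
    obtain ⟨a', b', e'⟩ := nonneg z' ((h q).1 - t * k, (h q).2 + t * (((k + l : ℕ) : ℤ) - k)) h5 h6
    have g := path p q (a + a') (b + b') p'
      ((h q).1 - t * k, (h q).2 + t * (((k + l : ℕ) : ℤ) - k)) h1 ⟨t, rfl, rfl⟩ (by
      rw [e', e, add_assoc]
      simp)
    obtain ⟨m, hm, -⟩ := g.split hG
    obtain ⟨w, rfl⟩ := Quotient.exists_rep m
    have hw : w ∈ ConnComp P x₀ := by
      refine mem_connComp_of_comparable p.2 ?_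
      by_cases hpw : SameFiber R B p.1 w
      · exact hpw.comparable
      · exact Or.inl (StepOf.le_of_posPath hR hB hcov hs hm hpw).le
    refine ⟨⟨w, hw⟩, (disp p ⟨w, hw⟩ a b hm).trans (CylRel.trans ?_ h2.symm)⟩
    obtain ⟨u, h7, h8⟩ := h1
    rw [e]
    exact ⟨u, by simp [h7]; ring, by simp [h8]; ring⟩
  · have size : ∀ p : ConnComp P x₀,
        splitSize k (k + l) h p = {v | SameFiber R B p.1 v}.ncard := by
      intro p
      rw [splitSize, ← Set.ncard_image_of_injective _ Subtype.val_injective]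
      congr 1
      ext v
      constructor
      · rintro ⟨q, hq, rfl⟩
        exact ((rel_iff q p).1 hq).symm
      · intro hv
        exact ⟨⟨v, mem_connComp_of_comparable p.2 hv.comparable⟩,
          (rel_iff ⟨v, _⟩ p).2 hv.symm, rfl⟩
    have east : ∀ (p q : ConnComp P x₀) (u v : ℤ × ℤ), CylRel k (k + l) (h p) u →
        CylRel k (k + l) (h q) v → v = u + (1, 0) →
        StepOf s R B (Quotient.mk s p.1) (Quotient.mk s q.1) := fun p q u v h1 h2 e =>
      (path p q 1 0 u v h1 h2 (by simpa using e)).step_e hG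
    have north : ∀ (p q : ConnComp P x₀) (u v : ℤ × ℤ), CylRel k (k + l) (h p) u →
        CylRel k (k + l) (h q) v → v = u + (0, 1) →
        StepOf s B R (Quotient.mk s p.1) (Quotient.mk s q.1) := fun p q u v h1 h2 e =>
      (path p q 0 1 u v h1 h2 (by simpa using e)).swap.step_e hG.swap
    rintro w x y z - - - - - - ⟨pw, px, py, pz, hw, hx, hy, hz, c1, c2, c3, c4, hne⟩
    rw [size, size, size, size]
    rcases covBy_int_prod c1 with e1 | e1 <;> rcases covBy_int_prod c2 with e2 | e2
    · exact absurd (e1.trans e2.symm) hne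
    · have e3 : pz = px + (0, 1) := by
        refine (covBy_int_prod c3).resolve_left fun e3 => ?_
        rcases covBy_int_prod c4 with e4 | e4 <;>
          simp [e3, e1, e2, Prod.ext_iff] at e4
        omega
      have e4 : pz = py + (1, 0) := by rw [e3, e1, e2]; abel
      exact StepOf.max_ncard_fiber_le hR hB hp hp' hcov hs (east w x pw px hw hx e1)
        (north w y pw py hw hy e2) (east y z py pz hy hz e4) (north x z px pz hx hz e3)
    · have e3 : pz = px + (1, 0) := by
        refine (covBy_int_prod c3).resolve_right fun e3 => ?_
        rcases covBy_int_prod c4 with e4 | e4 <;>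
          simp [e3, e1, e2, Prod.ext_iff] at e4
        omega
      have e4 : pz = py + (0, 1) := by rw [e3, e1, e2]; abel
      rw [min_comm]
      exact StepOf.max_ncard_fiber_le hR hB hp hp' hcov hs (east w y pw py hw hy e2)
        (north w x pw px hw hx e1) (east x z px pz hx hz e3) (north y z py pz hy hz e4)
    · exact absurd (e1.trans e2.symm) hne

end Forward

section CylinderSystem

variable {Q : Type*} [PartialOrder Q]

/-- A placement of the elements of `Q` on lattice points of the plane, invariant under
translation by `(-k, l)`, that exhibits `Q` as a splitting of a convex subposet of a cylinder. -/
structure CylSystem (k l : ℤ) (At : Q → ℤ → ℤ → Prop) : Prop where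
  two_le_left : 2 ≤ k
  two_le_right : 2 ≤ l
  exists_at : ∀ p, ∃ i j, At p i j
  shift : ∀ {p i j} (t : ℤ), At p i j → At p (i - t * k) (j + t * l)
  unique : ∀ {p i j i' j'}, At p i j → At p i' j' → ∃ t : ℤ, i' = i - t * k ∧ j' = j + t * l
  comparable : ∀ {p q i j}, At p i j → At q i j → p ≤ q ∨ q ≤ p
  lt : ∀ {p q i j i' j'}, At p i j → At q i' j' → i ≤ i' → j ≤ j' → i < i' ∨ j < j' → p < q
  exists_le : ∀ {p q i j}, p ≤ q → At p i j → ∃ i' j', At q i' j' ∧ i ≤ i' ∧ j ≤ j'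
  convex : ∀ {p q i j i' j' a b}, At p i j → At q i' j' → i ≤ a → a ≤ i' → j ≤ b → b ≤ j' →
    ∃ r, At r a b
  tech : ∀ {w x y z i j}, At w i j → At x (i + 1) j → At y i (j + 1) → At z (i + 1) (j + 1) →
    max {p | At p i j}.ncard {p | At p (i + 1) (j + 1)}.ncard ≤
      min {p | At p (i + 1) j}.ncard {p | At p i (j + 1)}.ncard

/-- `p` and `q` have positions in the same row. -/
def SameRow (At : Q → ℤ → ℤ → Prop) (p q : Q) : Prop := ∃ i i' j, At p i j ∧ At q i' j

/-- Comparison of sums over finsets whose symmetric difference is separated by a value. -/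
theorem Finset.sum_le_sum_of_separated {ι : Type*} [DecidableEq ι] {A J : Finset ι} {g : ι → ℕ}
    {c : ℕ} (h1 : ∀ x ∈ A \ J, g x ≤ c) (h2 : ∀ x ∈ J \ A, c ≤ g x) (h : A.card ≤ J.card) :
    ∑ x ∈ A, g x ≤ ∑ x ∈ J, g x := by
  have e1 := Finset.sum_inter_add_sum_sdiff A J g
  have e2 := Finset.sum_inter_add_sum_sdiff J A g
  rw [Finset.inter_comm] at e2
  have c1 := Finset.card_inter_add_card_sdiff A J
  have c2 := Finset.card_inter_add_card_sdiff J A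
  rw [Finset.inter_comm] at c2
  have s1 : ∑ x ∈ A \ J, g x ≤ (A \ J).card • c := Finset.sum_le_card_nsmul _ _ _ h1
  have s2 : (J \ A).card • c ≤ ∑ x ∈ J \ A, g x := Finset.card_nsmul_le_sum _ _ _ h2
  have s3 : (A \ J).card • c ≤ (J \ A).card • c := Nat.mul_le_mul_right _ (by omega)
  linarith

namespace CylSystem

variable {k l : ℤ} {At : Q → ℤ → ℤ → Prop}

theorem swap (hA : CylSystem k l At) : CylSystem l k fun p i j => At p j i where
  two_le_left := hA.two_le_right
  two_le_right := hA.two_le_left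
  exists_at p := exists_comm.1 (hA.exists_at p)
  shift t h := by simpa [sub_eq_add_neg] using hA.shift (-t) h
  unique h1 h2 := by
    obtain ⟨t, h3, h4⟩ := hA.unique h1 h2
    exact ⟨-t, by rw [h4]; ring, by rw [h3]; ring⟩
  comparable := hA.comparable
  lt h1 h2 h3 h4 h5 := hA.lt h1 h2 h4 h3 h5.symm
  exists_le h1 h2 := by
    obtain ⟨i, j, h3, h4, h5⟩ := hA.exists_le h1 h2
    exact ⟨j, i, h3, h5, h4⟩
  convex h1 h2 h3 h4 h5 h6 := hA.convex h1 h2 h5 h6 h3 h4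
  tech h1 h2 h3 h4 := by
    rw [min_comm]
    exact hA.tech h1 h3 h2 h4

theorem unique_row (hA : CylSystem k l At) {p i i' j} (h1 : At p i j) (h2 : At p i' j) :
    i = i' := by
  obtain ⟨t, h3, h4⟩ := hA.unique h1 h2
  have hl := hA.two_le_right
  have : t = 0 := by
    have : t * l = 0 := by omega
    rcases mul_eq_zero.1 this with h | h <;> omega
  simp [h3, this]

theorem sameRow_iff (hA : CylSystem k l At) {p q i j} (h : At p i j) :
    SameRow At p q ↔ ∃ i', At q i' j := by
  constructor
  · rintro ⟨a, a', b, h1, h2⟩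
    obtain ⟨t, h3, h4⟩ := hA.unique h1 h
    exact ⟨_, h4 ▸ hA.shift t h2⟩
  · rintro ⟨i', h'⟩
    exact ⟨i, i', j, h, h'⟩

theorem chainRel (hA : CylSystem k l At) : ChainRel (SameRow At) where
  refl p := by
    obtain ⟨i, j, h⟩ := hA.exists_at p
    exact ⟨i, i, j, h, h⟩
  symm := by
    rintro p q ⟨i, i', j, h1, h2⟩
    exact ⟨i', i, j, h2, h1⟩
  trans := by
    rintro p q r ⟨i, i', j, h1, h2⟩ h3
    obtain ⟨a, h4⟩ := (hA.sameRow_iff h2).1 h3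
    exact ⟨i, a, j, h1, h4⟩
  total := by
    rintro p q ⟨i, i', j, h1, h2⟩
    rcases lt_trichotomy i i' with h | rfl | h
    · exact Or.inl (hA.lt h1 h2 h.le le_rfl (Or.inl h)).le
    · exact hA.comparable h1 h2
    · exact Or.inr (hA.lt h2 h1 h.le le_rfl (Or.inl h)).le
  sat := by
    rintro p q ⟨i, i', j, h1, h2⟩ hlt hz
    refine ⟨hlt, fun c hpc hcq => ?_⟩
    have hrow := fun z a (h : At z a j) => hz z ⟨i, a, j, h1, h⟩
    obtain ⟨a, b, h3, h4, h5⟩ := hA.exists_le hpc.le h1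
    obtain ⟨a', b', h6, h7, h8⟩ := hA.exists_le hcq.le h3
    obtain ⟨t, h9, h10⟩ := hA.unique h2 h6
    have hk := hA.two_le_left
    have hl := hA.two_le_right
    have ht : 0 ≤ t := by
      by_contra hneg
      have : t * l ≤ -1 * l := mul_le_mul_of_nonneg_right (by omega) (by omega)
      omega
    rcases ht.eq_or_lt with rfl | ht
    · obtain rfl : b = j := by omega
      exact hrow c a h3 ⟨hpc, hcq⟩
    · have : 1 * k ≤ t * k := mul_le_mul_of_nonneg_right (by omega) (by omega)
      obtain ⟨r, hr⟩ := hA.convex (a := i + 1) (b := j) h1 h2 (by omega) (by omega) le_rfl le_rfl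
      exact hrow r _ hr ⟨hA.lt h1 hr (by omega) le_rfl (by omega),
        hA.lt hr h2 (by omega) le_rfl (by omega)⟩

theorem sameRow_or_of_covBy (hA : CylSystem k l At) {p q : Q} (h : p ⋖ q) :
    SameRow At p q ∨ SameRow (fun p i j => At p j i) p q := by
  obtain ⟨i, j, h1⟩ := hA.exists_at p
  obtain ⟨i', j', h2, h3, h4⟩ := hA.exists_le h.le h1
  rcases h3.eq_or_lt with rfl | h3
  · exact Or.inr ⟨j, j', i, h1, h2⟩
  rcases h4.eq_or_lt with rfl | h4
  · exact Or.inl ⟨i, i', j, h1, h2⟩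
  obtain ⟨r, hr⟩ := hA.convex (a := i + 1) (b := j) h1 h2 (by omega) (by omega) le_rfl h4.le
  exact absurd (hA.lt hr h2 (by omega) h4.le (Or.inr h4))
    (h.2 (hA.lt h1 hr (by omega) le_rfl (by omega)))

theorem ncard_column [Finite Q] (hA : CylSystem k l At) (i : ℤ) (X : Finset ℤ) :
    {p | ∃ j ∈ X, At p i j}.ncard = ∑ j ∈ X, {p | At p i j}.ncard := by
  induction X using Finset.induction_on with
  | empty => simp
  | @insert a X ha ih =>
    rw [Finset.sum_insert ha, ← ih, ← Set.ncard_union_eq _ (Set.toFinite _) (Set.toFinite _)]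
    · congr 1
      ext p
      simp
    · refine Set.disjoint_left.2 fun p h1 ⟨j, hj, h2⟩ => ha ?_
      rwa [hA.swap.unique_row h1 h2]

theorem pushUp_of_covBy [Finite Q] (hA : CylSystem k l At) {U : Set Q}
    (hU : ∀ p q, SameRow At p q → p ≤ q → p ∈ U → q ∈ U) {y z : Q} (hyz : y ⋖ z)
    (hrow : SameRow At y z)
    (hle : {v | SameRow (fun p i j => At p j i) y v ∧ y ≤ v}.ncard ≤
      {v | SameRow (fun p i j => At p j i) y v ∧ v ∈ U}.ncard) :
    {v | SameRow (fun p i j => At p j i) z v ∧ z ≤ v}.ncard ≤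
      {v | SameRow (fun p i j => At p j i) z v ∧ v ∈ U}.ncard := by
  classical
  obtain ⟨i, i', j, hy, hz⟩ := hrow
  have coly : ∀ v, SameRow (fun p i j => At p j i) y v ↔ ∃ b, At v i b := fun v =>
    hA.swap.sameRow_iff hy
  have colz : ∀ v, SameRow (fun p i j => At p j i) z v ↔ ∃ b, At v i' b := fun v =>
    hA.swap.sameRow_iff hz
  simp only [coly] at hle
  simp only [colz]
  rcases lt_trichotomy i i' with hlt | rfl | hlt
  rotate_left
  · refine le_trans (Set.ncard_le_ncard ?_ (Set.toFinite _)) hle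
    exact fun v hv => ⟨hv.1, hyz.le.trans hv.2⟩
  · exact absurd (hA.lt hz hy hlt.le le_rfl (Or.inl hlt)) hyz.lt.asymm
  obtain rfl : i' = i + 1 := by
    by_contra hne
    obtain ⟨r, hr⟩ := hA.convex (a := i + 1) (b := j) hy hz (by omega) (by omega) le_rfl le_rfl
    exact hyz.2 (hA.lt hy hr (by omega) le_rfl (by omega))
      (hA.lt hr hz (by omega) le_rfl (by omega))
  have hfin : {b | (∃ p, At p i b) ∧ ∃ p, At p (i + 1) b}.Finite := by
    refine Set.Finite.subset (s := ⋃ p : Q, {b | At p i b}) (Set.finite_iUnion fun p => ?_) ?_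
    · exact Set.Subsingleton.finite fun b hb b' hb' => hA.swap.unique_row hb hb'
    · rintro b ⟨⟨p, hp⟩, -⟩
      exact Set.mem_iUnion.2 ⟨p, hp⟩
  let O := hfin.toFinset
  have hO : ∀ b, b ∈ O ↔ (∃ p, At p i b) ∧ ∃ p, At p (i + 1) b := fun b => hfin.mem_toFinset
  have hjO : j ∈ O := (hO j).2 ⟨⟨y, hy⟩, z, hz⟩
  have lowO : ∀ {p b}, At p i b → b ≤ j → b ∈ O := fun hp hb =>
    (hO _).2 ⟨⟨_, hp⟩, hA.convex hp hz (by omega) le_rfl le_rfl hb⟩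
  have highO : ∀ {p b}, At p (i + 1) b → j ≤ b → b ∈ O := fun hp hb =>
    (hO _).2 ⟨hA.convex hy hp le_rfl (by omega) hb le_rfl, _, hp⟩
  have conn : (O : Set ℤ).OrdConnected := by
    refine ⟨fun a ha c hc b hb => ?_⟩
    obtain ⟨⟨p, hp⟩, p', hp'⟩ := (hO a).1 ha
    obtain ⟨⟨q, hq⟩, q', hq'⟩ := (hO c).1 hc
    exact (hO b).2 ⟨hA.convex hp hq le_rfl le_rfl hb.1 hb.2,
      hA.convex hp' hq' le_rfl le_rfl hb.1 hb.2⟩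
  have tech : ∀ b, b ∈ O → b + 1 ∈ O →
      {p | At p i b}.ncard ≤ {p | At p i (b + 1)}.ncard ∧
      {p | At p (i + 1) (b + 1)}.ncard ≤ {p | At p (i + 1) b}.ncard := by
    intro b hb hb'
    obtain ⟨⟨p, hp⟩, p', hp'⟩ := (hO _).1 hb
    obtain ⟨⟨q, hq⟩, q', hq'⟩ := (hO _).1 hb'
    have h := hA.tech hp hp' hq hq'
    rw [max_le_iff, le_min_iff, le_min_iff] at h
    exact ⟨h.1.2, h.2.1⟩
  have mono : MonotoneOn (fun b => {p | At p i b}.ncard) (O : Set ℤ) :=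
    monotoneOn_of_le_add_one conn fun b _ hb hb' => (tech b hb hb').1
  have anti : AntitoneOn (fun b => {p | At p (i + 1) b}.ncard) (O : Set ℤ) :=
    antitoneOn_of_add_one_le conn fun b _ hb hb' => (tech b hb hb').2
  let J := O.filter fun b => ∃ p ∈ U, At p i b
  have hJO : J ⊆ O := Finset.filter_subset _ _
  let T : Set Q := {p | ∃ b, At p i b ∧ j < b ∧ b ∉ O}
  have c1 : 1 + ∑ b ∈ O.filter (j < ·), {p | At p i b}.ncard + T.ncard ≤
      {v | (∃ b, At v i b) ∧ y ≤ v}.ncard := by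
    rw [← hA.ncard_column i, ← Set.ncard_singleton y, ← Set.ncard_union_eq _ (Set.toFinite _)
      (Set.toFinite _), ← Set.ncard_union_eq _ (Set.toFinite _) (Set.toFinite _)]
    · refine Set.ncard_le_ncard ?_ (Set.toFinite _)
      rintro v ((rfl | ⟨b, hb, hv⟩) | ⟨b, hv, hb, -⟩)
      · exact ⟨⟨j, hy⟩, le_rfl⟩
      · have := (Finset.mem_filter.1 hb).2
        exact ⟨⟨b, hv⟩, (hA.lt hy hv le_rfl this.le (Or.inr this)).le⟩
      · exact ⟨⟨b, hv⟩, (hA.lt hy hv le_rfl hb.le (Or.inr hb)).le⟩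
    · refine Set.disjoint_left.2 ?_
      rintro v (rfl | ⟨b, hb, hv⟩) ⟨b', hv', hb', hb''⟩
      · exact hb'.ne (hA.swap.unique_row hy hv')
      · rw [hA.swap.unique_row hv hv'] at hb
        exact hb'' (Finset.mem_filter.1 hb).1
    · refine Set.disjoint_left.2 ?_
      rintro v rfl ⟨b, hb, hv⟩
      exact (Finset.mem_filter.1 hb).2.ne (hA.swap.unique_row hy hv)
  have c2 : {v | (∃ b, At v i b) ∧ v ∈ U}.ncard ≤ ∑ b ∈ J, {p | At p i b}.ncard + T.ncard := by
    rw [← hA.ncard_column i]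
    refine le_trans (Set.ncard_le_ncard ?_ (Set.toFinite _)) (Set.ncard_union_le _ _)
    rintro v ⟨⟨b, hv⟩, hvU⟩
    by_cases hb : b ∈ O
    · exact Or.inl ⟨b, Finset.mem_filter.2 ⟨hb, v, hvU, hv⟩, hv⟩
    · exact Or.inr ⟨b, hv, lt_of_not_ge fun h => hb (lowO hv h), hb⟩
  have hcard : (O.filter (j ≤ ·)).card ≤ J.card := by
    have e : O.filter (j ≤ ·) = insert j (O.filter (j < ·)) := by
      ext b
      simp only [Finset.mem_filter, Finset.mem_insert, le_iff_eq_or_lt]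
      constructor
      · rintro ⟨h1, rfl | h2⟩
        · exact Or.inl rfl
        · exact Or.inr ⟨h1, h2⟩
      · rintro (rfl | ⟨h1, h2⟩)
        · exact ⟨hjO, Or.inl rfl⟩
        · exact ⟨h1, Or.inr h2⟩
    rw [e, Finset.card_insert_of_notMem (by simp)]
    by_contra hlt
    have : ∑ b ∈ J, {p | At p i b}.ncard ≤ ∑ b ∈ O.filter (j < ·), {p | At p i b}.ncard := by
      refine Finset.sum_le_sum_of_separated (c := {p | At p i j}.ncard) (fun b hb => ?_)
        (fun b hb => ?_) (by omega)
      · obtain ⟨h1, h2⟩ := Finset.mem_sdiff.1 hb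
        exact mono (hJO h1) hjO (not_lt.1 fun h => h2 (Finset.mem_filter.2 ⟨hJO h1, h⟩))
      · rw [Finset.mem_sdiff, Finset.mem_filter] at hb
        exact mono hjO hb.1.1 hb.1.2.le
    omega
  calc {v | (∃ b, At v (i + 1) b) ∧ z ≤ v}.ncard
      ≤ {v | ∃ b ∈ O.filter (j ≤ ·), At v (i + 1) b}.ncard := by
        refine Set.ncard_le_ncard ?_ (Set.toFinite _)
        rintro v ⟨⟨b, hv⟩, hzv⟩
        have hjb : j ≤ b := by
          by_contra hlt
          rw [not_le] at hlt
          exact absurd (hA.lt hv hz le_rfl hlt.le (Or.inr hlt)) (not_lt_of_ge hzv)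
        exact ⟨b, Finset.mem_filter.2 ⟨highO hv hjb, hjb⟩, hv⟩
    _ = ∑ b ∈ O.filter (j ≤ ·), {p | At p (i + 1) b}.ncard := hA.ncard_column _ _
    _ ≤ ∑ b ∈ J, {p | At p (i + 1) b}.ncard := by
        refine Finset.sum_le_sum_of_separated (c := {p | At p (i + 1) j}.ncard) (fun b hb => ?_)
          (fun b hb => ?_) hcard
        · rw [Finset.mem_sdiff, Finset.mem_filter] at hb
          exact anti hjO hb.1.1 hb.1.2
        · obtain ⟨h1, h2⟩ := Finset.mem_sdiff.1 hb
          exact anti (hJO h1) hjO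
            (not_le.1 fun h => h2 (Finset.mem_filter.2 ⟨hJO h1, h⟩)).le
    _ = {v | ∃ b ∈ J, At v (i + 1) b}.ncard := (hA.ncard_column _ _).symm
    _ ≤ {v | (∃ b, At v (i + 1) b) ∧ v ∈ U}.ncard := by
        refine Set.ncard_le_ncard ?_ (Set.toFinite _)
        rintro v ⟨b, hb, hv⟩
        obtain ⟨-, p, hpU, hp⟩ := Finset.mem_filter.1 hb
        exact ⟨⟨b, hv⟩, hU p v ⟨i, i + 1, b, hp, hv⟩
          (hA.lt hp hv (by omega) le_rfl (by omega)).le hpU⟩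

theorem pushUp [Finite Q] (hA : CylSystem k l At) :
    PushUp (SameRow At) (SameRow fun p i j => At p j i) := by
  intro U hU y z hyz hle hcard
  induction y using WellFoundedGT.induction with
  | ind y ih =>
    rcases hle.eq_or_lt with rfl | hlt
    · exact hcard
    · obtain ⟨s, h1, h2, h3⟩ := hA.chainRel.exists_succ hyz hlt
      exact ih s h1.lt (hA.chainRel.trans (hA.chainRel.symm h2) hyz) h3
        (hA.pushUp_of_covBy hU h1 h2 hcard)

theorem inN2 [Finite Q] (hA : CylSystem k l At) : InN2 Q :=
  inN2_iff.2 ⟨_, _, hA.chainRel, hA.swap.chainRel, hA.pushUp, hA.swap.pushUp,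
    fun _ _ => hA.sameRow_or_of_covBy⟩

end CylSystem

end CylinderSystem

theorem inN2_of_total {Q : Type*} [PartialOrder Q] [Finite Q] (h : ∀ p q : Q, p ≤ q ∨ q ≤ p) :
    InN2 Q := by
  refine CylSystem.inN2 (k := 2) (l := 2) (At := fun _ i j => ∃ t : ℤ, i = -t * 2 ∧ j = t * 2)
    { two_le_left := le_rfl
      two_le_right := le_rfl
      exists_at := fun _ => ⟨0, 0, 0, by simp⟩
      shift := ?_
      unique := ?_
      comparable := fun _ _ => h _ _
      lt := ?_
      exists_le := fun _ h2 => ⟨_, _, h2, le_rfl, le_rfl⟩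
      convex := ?_
      tech := ?_ }
  · rintro p i j t ⟨u, rfl, rfl⟩
    exact ⟨u + t, by ring, by ring⟩
  · rintro p i j i' j' ⟨u, rfl, rfl⟩ ⟨v, rfl, rfl⟩
    exact ⟨v - u, by ring, by ring⟩
  · rintro p q i j i' j' ⟨u, rfl, rfl⟩ ⟨v, rfl, rfl⟩ h1 h2 h3
    omega
  · rintro p q i j i' j' a b ⟨u, rfl, rfl⟩ ⟨v, rfl, rfl⟩ h1 h2 h3 h4
    exact ⟨p, u, by omega, by omega⟩
  · rintro w x y z i j ⟨u, rfl, rfl⟩ ⟨v, h1, h2⟩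
    omega

section Backward

variable {k n : ℕ}

/-- A point of the cylinder lying between two corners of a unit box has a representative in
that box. -/
theorem exists_cylRel_of_between (hk : 2 ≤ k) (hn : k + 2 ≤ n) {i j i' j' : ℤ} {r : ℤ × ℤ}
    (hi : i' ≤ i + 1) (hj : j' ≤ j + 1) (h1 : CylLe k n (i, j) r) (h2 : CylLe k n r (i', j')) :
    ∃ a b, CylRel k n r (a, b) ∧ i ≤ a ∧ a ≤ i' ∧ j ≤ b ∧ b ≤ j' := by
  obtain ⟨t, h3, h4⟩ := cylLe_iff.1 h1
  obtain ⟨u, h5, h6⟩ := cylLe_iff.1 h2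
  dsimp only at h3 h4 h5 h6
  have hk' : (2 : ℤ) ≤ k := by exact_mod_cast hk
  have hl : (2 : ℤ) ≤ (n : ℤ) - k := by omega
  have h7 : t + u ≤ 0 := by
    by_contra! h
    nlinarith
  have h8 : 0 ≤ t + u := by
    by_contra! h
    nlinarith
  obtain rfl : u = -t := by omega
  exact ⟨r.1 - t * k, r.2 + t * ((n : ℤ) - k), ⟨t, rfl, rfl⟩, h3, by linarith, h4, by linarith⟩

/-- Distinct comparable lattice points in a common unit box stay distinct on the cylinder. -/
theorem not_cylRel_of_lt (hk : 0 < k) (hkn : k < n) {i j i' j' : ℤ} (hi : i ≤ i') (hj : j ≤ j')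
    (h : i < i' ∨ j < j') : ¬CylRel k n (i, j) (i', j') := by
  rintro ⟨t, h1, h2⟩
  dsimp only at h1 h2
  have hl : (0 : ℤ) < (n : ℤ) - k := by omega
  have hk' : (0 : ℤ) < k := by omega
  rcases lt_trichotomy t 0 with ht | rfl | ht
  · nlinarith
  · omega
  · nlinarith

theorem cylCov_of_adjacent {Q : Type*} [PartialOrder Q] (hk : 2 ≤ k) (hn : k + 2 ≤ n)
    {h : Q → ℤ × ℤ} {p q : Q} {i j i' j' : ℤ} (hp : CylRel k n (h p) (i, j))
    (hq : CylRel k n (h q) (i', j')) (hij : i' = i + 1 ∧ j' = j ∨ i' = i ∧ j' = j + 1) :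
    CylCov k n h p q := by
  refine ⟨⟨fun h1 => not_cylRel_of_lt (k := k) (n := n) (i := i) (j := j) (i' := i') (j' := j')
    (by omega) (by omega) (by omega) (by omega) (by omega) ((hp.symm.trans h1).trans hq), ?_⟩, ?_⟩
  · exact ⟨_, _, hp, hq, by dsimp only; omega, by dsimp only; omega⟩
  · rintro v ⟨⟨h1, h2⟩, h3, h4⟩
    obtain ⟨a, b, h5, h6, h7, h8, h9⟩ := exists_cylRel_of_between (i' := i') (j' := j') hk hn
      (by omega) (by omega) (hp.symm.cylLe.trans h2) (h4.trans hq.cylLe)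
    obtain ⟨rfl, rfl⟩ | ⟨rfl, rfl⟩ : a = i ∧ b = j ∨ a = i' ∧ b = j' := by omega
    · exact h1 (hp.trans h5.symm)
    · exact h3 (h5.trans hq.symm)

theorem splitSize_eq {Q : Type*} [PartialOrder Q] {h : Q → ℤ × ℤ} {p : Q} {z : ℤ × ℤ}
    (hp : CylRel k n (h p) z) : splitSize k n h p = {q | CylRel k n (h q) z}.ncard :=
  congrArg Set.ncard (Set.ext fun _ => ⟨fun hq => hq.trans hp, fun hq => hq.trans hp.symm⟩)

theorem cylSystem_of_cylReduction {Q : Type*} [PartialOrder Q] (hk : 2 ≤ k) (hn : k + 2 ≤ n)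
    {h : Q → ℤ × ℤ} (hh : IsCylReduction k n h) (ht : TechCondition k n h) :
    CylSystem (k : ℤ) ((n : ℤ) - k) fun p i j => CylRel k n (h p) (i, j) where
  two_le_left := by omega
  two_le_right := by omega
  exists_at p := ⟨_, _, .refl (h p)⟩
  shift t hp := hp.trans ⟨t, rfl, rfl⟩
  unique hp hq := hp.symm.trans hq
  comparable := fun {p q i j} hp hq => by
    rcases eq_or_ne p q with rfl | hpq
    · exact .inl le_rfl
    · exact hh.1 (i, j) hp hq hpq
  lt := fun {p q i j i' j'} hp hq hi hj hij => by
    have h1 : ¬CylRel k n (h p) (h q) := fun h1 =>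
      not_cylRel_of_lt (by omega) (by omega) hi hj hij ((hp.symm.trans h1).trans hq)
    refine lt_of_le_of_ne ((hh.2.1 p q h1).2 ⟨_, _, hp, hq, hi, hj⟩) ?_
    rintro rfl
    exact h1 (.refl _)
  exists_le := fun {p q i j} hpq hp => by
    by_cases h1 : CylRel k n (h p) (h q)
    · exact ⟨i, j, h1.symm.trans hp, le_rfl, le_rfl⟩
    · obtain ⟨t, h2, h3⟩ := cylLe_iff.1 (hp.symm.cylLe.trans ((hh.2.1 p q h1).1 hpq))
      exact ⟨_, _, ⟨t, rfl, rfl⟩, h2, h3⟩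
  convex := fun {p q i j i' j' a b} hp hq h1 h2 h3 h4 =>
    hh.2.2 p q (a, b) ⟨_, _, hp, .refl _, h1, h3⟩ ⟨_, _, .refl _, hq, h2, h4⟩
  tech := fun {w x y z i j} hw hx hy hz => by
    rw [← splitSize_eq hw, ← splitSize_eq hx, ← splitSize_eq hy, ← splitSize_eq hz]
    refine ht w x y z (cylCov_of_adjacent hk hn hw hx (by omega))
      (cylCov_of_adjacent hk hn hw hy (by omega)) (cylCov_of_adjacent hk hn hx hz (by omega))
      (cylCov_of_adjacent hk hn hy hz (by omega)) ?_ ?_ ⟨_, _, _, _, hw, hx, hy, hz, ?_⟩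
    · intro hxy
      obtain ⟨t, h1, h2⟩ := (hx.symm.trans hxy).trans hy
      dsimp only at h1 h2
      have hk' : (2 : ℤ) ≤ k := by exact_mod_cast hk
      rcases le_or_gt t 0 with ht | ht <;> nlinarith
    · intro v h1 h2
      obtain ⟨a, b, h3, h4⟩ := exists_cylRel_of_between (i' := i + 1) (j' := j + 1) hk hn
        le_rfl le_rfl (hw.symm.cylLe.trans h1) (h2.trans hz.cylLe)
      obtain ⟨rfl | rfl, rfl | rfl⟩ : (a = i ∨ a = i + 1) ∧ (b = j ∨ b = j + 1) := by omega
      · exact .inl (h3.trans hw.symm)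
      · exact .inr (.inr (.inl (h3.trans hy.symm)))
      · exact .inr (.inl (h3.trans hx.symm))
      · exact .inr (.inr (.inr (h3.trans hz.symm)))
    · simp [Prod.mk_covBy_mk_iff, Order.covBy_add_one]

theorem inN2_of_cylReduction {Q : Type*} [PartialOrder Q] [Finite Q] (hk : 0 < k) (hkn : k < n)
    {h : Q → ℤ × ℤ} (hh : IsCylReduction k n h) (ht : TechCondition k n h) : InN2 Q := by
  by_cases hc : 2 ≤ k ∧ k + 2 ≤ n
  · exact (cylSystem_of_cylReduction hc.1 hc.2 hh ht).inN2
  · refine inN2_of_total fun p q => ?_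
    by_cases hpq : CylRel k n (h p) (h q)
    · rcases eq_or_ne p q with rfl | hne
      · exact .inl le_rfl
      · exact hh.1 (h q) hpq (CylRel.refl _) hne
    · rw [hh.2.1 p q hpq, hh.2.1 q p fun h => hpq h.symm, cylLe_iff, cylLe_iff]
      rcases (by omega : k = 1 ∨ n = k + 1) with rfl | rfl
      · push_cast
        set t := (h q).1 - (h p).1
        rcases le_total (h p).2 ((h q).2 + t * ((n : ℤ) - 1)) with h1 | h1
        · exact .inl ⟨t, by omega, h1⟩
        · exact .inr ⟨-t, by omega, by linarith⟩
      · push_cast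
        set t := (h p).2 - (h q).2
        rcases le_total (h p).1 ((h q).1 - t * k) with h1 | h1
        · exact .inl ⟨t, h1, by linarith⟩
        · exact .inr ⟨-t, by linarith, by linarith⟩

end Backward

section Components

variable {P : Type*}

/-- The relation on a type glued from relations on a family of subsets indexed by a map. -/
def Glue (f : P → Set P) (R : ∀ S : Set P, S → S → Prop) (p q : P) : Prop :=
  f p = f q ∧ ∃ (hp : p ∈ f p) (hq : q ∈ f p), R (f p) ⟨p, hp⟩ ⟨q, hq⟩

variable {f : P → Set P} {R B : ∀ S : Set P, S → S → Prop}

theorem Glue.iff_of_mem (hf : ∀ p q, q ∈ f p ↔ f p = f q) {p q r : P} (hp : p ∈ f r)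
    (hq : q ∈ f r) : Glue f R p q ↔ R (f r) ⟨p, hp⟩ ⟨q, hq⟩ := by
  have transfer : ∀ {S T : Set P} (e : S = T) (h1 : p ∈ S) (h2 : q ∈ S),
      R S ⟨p, h1⟩ ⟨q, h2⟩ → R T ⟨p, e ▸ h1⟩ ⟨q, e ▸ h2⟩ := by
    rintro S _ rfl _ _ h
    exact h
  have e := (hf r p).1 hp
  exact ⟨fun ⟨_, h1, h2, h3⟩ => transfer e.symm h1 h2 h3,
    fun h => ⟨e.symm.trans ((hf r q).1 hq), _, _, transfer e hp hq h⟩⟩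

theorem Glue.mem_right {p q : P} (h : Glue f R p q) : q ∈ f p := h.2.2.1

theorem Glue.ncard_eq (hf : ∀ p q, q ∈ f p ↔ f p = f q) {p r : P} (hp : p ∈ f r) (X : Set P) :
    {v | Glue f B p v ∧ v ∈ X}.ncard =
      {v : f r | B (f r) ⟨p, hp⟩ v ∧ (v : P) ∈ X}.ncard := by
  rw [← Set.ncard_image_of_injective _ Subtype.val_injective]
  congr 1
  ext v
  constructor
  · rintro ⟨h1, h2⟩
    have hv : v ∈ f r := (hf r v).2 (((hf r p).1 hp).trans h1.1)
    exact ⟨⟨v, hv⟩, ⟨(Glue.iff_of_mem hf hp hv).1 h1, h2⟩, rfl⟩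
  · rintro ⟨⟨v, hv⟩, ⟨h1, h2⟩, rfl⟩
    exact ⟨(Glue.iff_of_mem hf hp hv).2 h1, h2⟩

variable [PartialOrder P]

theorem Glue.chainRel (hf : ∀ p q, q ∈ f p ↔ f p = f q) (hle : ∀ p q, p ≤ q → f p = f q)
    (hR : ∀ p, ChainRel (R (f p))) : ChainRel (Glue f R) where
  refl p := (Glue.iff_of_mem hf ((hf p p).2 rfl) ((hf p p).2 rfl)).2 ((hR p).refl _)
  symm := fun {p q} h => by
    rw [Glue.iff_of_mem hf h.mem_right ((hf p p).2 rfl)]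
    exact (hR p).symm h.2.2.2
  trans := fun {p q r} h h' => by
    have hr : r ∈ f p := (hf p r).2 (h.1.trans h'.1)
    have hq := h.mem_right
    have hp := (hf p p).2 rfl
    rw [Glue.iff_of_mem hf hq hr] at h'
    rw [Glue.iff_of_mem hf hp hq] at h
    rw [Glue.iff_of_mem hf hp hr]
    exact (hR p).trans h h'
  total := fun {p q} h => (hR p).total h.2.2.2
  sat := fun {p q} h hlt hz => by
    have hcov := (hR p).sat h.2.2.2 hlt fun z hz1 hz2 =>
      hz z ((Glue.iff_of_mem hf h.2.1 z.2).2 hz1) hz2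
    exact ⟨hlt, fun z h1 h2 => hcov.2 (c := ⟨z, (hf p z).2 (hle p z h1.le)⟩) h1 h2⟩

theorem Glue.pushUp (hf : ∀ p q, q ∈ f p ↔ f p = f q) (h : ∀ p, PushUp (R (f p)) (B (f p))) :
    PushUp (Glue f R) (Glue f B) := by
  intro U hU y z hyz hle
  have hy := (hf y y).2 rfl
  have hz := hyz.mem_right
  have e1 := Glue.ncard_eq (B := B) hf hy (Set.Ici y)
  have e2 := Glue.ncard_eq (B := B) hf hy U
  have e3 := Glue.ncard_eq (B := B) hf hz (Set.Ici z)
  have e4 := Glue.ncard_eq (B := B) hf hz U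
  simp only [Set.mem_Ici] at e1 e3
  rw [e1, e2, e3, e4]
  exact h y {v | (v : P) ∈ U}
    (fun p q hpq hle' => hU p q ((Glue.iff_of_mem hf p.2 q.2).2 hpq) hle')
    ⟨y, hy⟩ ⟨z, hz⟩ ((Glue.iff_of_mem hf hy hz).1 hyz) hle

theorem mem_connComp_comm {p q : P} (h : q ∈ ConnComp P p) : p ∈ ConnComp P q :=
  have : Std.Symm fun a b : P => a ≤ b ∨ b ≤ a := ⟨fun _ _ => Or.symm⟩
  Std.Symm.symm (r := Relation.ReflTransGen fun a b : P => a ≤ b ∨ b ≤ a) _ _ h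

theorem connComp_eq_iff (p q : P) : q ∈ ConnComp P p ↔ ConnComp P p = ConnComp P q :=
  ⟨fun h => Set.ext fun _ => ⟨(mem_connComp_comm h).trans, h.trans⟩,
    fun h => h ▸ Relation.ReflTransGen.refl⟩

theorem inN2_of_connComp [Finite P] (h : ∀ x : P, InN2 (ConnComp P x)) : InN2 P := by
  have h' : ∀ S : Set P, ∃ R B : S → S → Prop, S ∈ Set.range (ConnComp P) →
      ChainRel R ∧ ChainRel B ∧ PushUp R B ∧ PushUp B R ∧ ∀ x y : S, x ⋖ y → R x y ∨ B x y := by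
    intro S
    by_cases hS : S ∈ Set.range (ConnComp P)
    · obtain ⟨x, rfl⟩ := hS
      obtain ⟨R, B, h1⟩ := inN2_iff.1 (h x)
      exact ⟨R, B, fun _ => h1⟩
    · exact ⟨fun _ _ => True, fun _ _ => True, fun h1 => absurd h1 hS⟩
  choose R B hRB using h'
  have key := fun p : P => hRB _ ⟨p, rfl⟩
  have hle : ∀ p q : P, p ≤ q → ConnComp P p = ConnComp P q := fun p q hpq =>
    (connComp_eq_iff p q).1 (mem_connComp_of_comparable .refl (.inl hpq))
  refine inN2_iff.2 ⟨Glue (ConnComp P) R, Glue (ConnComp P) B,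
    Glue.chainRel connComp_eq_iff hle fun p => (key p).1,
    Glue.chainRel connComp_eq_iff hle fun p => (key p).2.1,
    Glue.pushUp connComp_eq_iff fun p => (key p).2.2.1,
    Glue.pushUp connComp_eq_iff fun p => (key p).2.2.2.1, fun x y hxy => ?_⟩
  have hx : x ∈ ConnComp P x := .refl
  have hy : y ∈ ConnComp P x := (connComp_eq_iff x y).2 (hle x y hxy.le)
  rw [Glue.iff_of_mem connComp_eq_iff hx hy, Glue.iff_of_mem connComp_eq_iff hx hy]
  exact (key x).2.2.2.2 _ _ ⟨hxy.lt, fun z h1 h2 => hxy.2 h1 h2⟩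

end Components

/-- Classification of `N₂`: a finite poset has the non-messing-up property if and only if
each of its connected components reduces to a convex subposet of a cylinder poset
`Cyl_{k,n}` subject to the technical condition on four-element diamonds that do not go
around the cylinder. -/
theorem inN2_iff_cylinder_reduction {P : Type*} [PartialOrder P] [Finite P] :
    InN2 P ↔ ∀ x₀ : P, ∃ k n : ℕ, 0 < k ∧ k < n ∧
      ∃ h : ↥(ConnComp P x₀) → ℤ × ℤ, IsCylReduction k n h ∧ TechCondition k n h := by
  refine ⟨exists_cylReduction, fun H => inN2_of_connComp fun x => ?_⟩
  obtain ⟨k, n, hk, hkn, h, h1, h2⟩ := H x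
  exact inN2_of_cylReduction hk hkn h1 h2
end

section
/- Neither of the classes N₂′ and N₂″ is contained in the other: there exists a finite poset in N₂″ that is not in N₂′, and there exists a finite poset in N₂′ that is not in N₂″. -/
/-- The class `N₂′`: posets with the non-messing-up property via a pair of chain covers
such that no chain of either cover is contained in a chain of the other cover. -/
def InN2p (P : Type*) [PartialOrder P] : Prop :=
  ∃ C₁ C₂, NMUvia P C₁ C₂ ∧ ∀ c₁ ∈ C₁, ∀ c₂ ∈ C₂, ¬c₁ ⊆ c₂ ∧ ¬c₂ ⊆ c₁

/-- The class `N₂″`: posets with the non-messing-up property via a pair of chain covers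
any two of whose differently colored chains meet in at most one element. -/
def InN2pp (P : Type*) [PartialOrder P] : Prop :=
  ∃ C₁ C₂, NMUvia P C₁ C₂ ∧ ∀ c₁ ∈ C₁, ∀ c₂ ∈ C₂, (c₁ ∩ c₂).encard ≤ 1

/-- The one-point poset lies in `N₂″`. -/
theorem inN2pp_unit : InN2pp Unit := by
  have hcov : IsChainCover Unit {Set.univ} := by
    refine ⟨?_, Set.pairwiseDisjoint_singleton _ _, fun x => ⟨Set.univ, rfl, trivial⟩⟩
    rintro c -
    exact ⟨fun x _ y _ h => (h (Subsingleton.elim x y)).elim,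
      fun x _ y _ h => (h.ne (Subsingleton.elim x y)).elim⟩
  have hsorted : ∀ nu : Unit → ℝ, SortedAlong Unit {Set.univ} nu :=
    fun nu c _ x _ y _ _ => le_of_eq (congrArg nu (Subsingleton.elim x y))
  refine ⟨{Set.univ}, {Set.univ}, ⟨hcov, hcov, fun _ _ nu _ _ => hsorted nu,
    fun _ _ nu _ _ => hsorted nu, fun x y h => (h.lt.ne (Subsingleton.elim x y)).elim⟩, ?_⟩
  exact fun c₁ _ c₂ _ => Set.encard_le_one_iff_subsingleton.2 Set.subsingleton_of_subsingleton

/-- The one-point poset does not lie in `N₂′`. -/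
theorem not_inN2p_unit : ¬InN2p Unit := by
  rintro ⟨C₁, C₂, ⟨⟨-, -, h₁⟩, ⟨-, -, h₂⟩, -⟩, h⟩
  obtain ⟨c₁, hc₁, hx₁⟩ := h₁ ()
  obtain ⟨c₂, hc₂, hx₂⟩ := h₂ ()
  exact (h c₁ hc₁ c₂ hc₂).1 fun _ _ => hx₂

/-- The underlying type of the poset `0 < {1, 2} < {3, 4}`, the ordinal sum of a point and two
two-element antichains. -/
def Tower : Type := Fin 5

namespace Tower

instance : Fintype Tower := inferInstanceAs (Fintype (Fin 5))

instance : DecidableEq Tower := inferInstanceAs (DecidableEq (Fin 5))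

instance (n : ℕ) [h : OfNat (Fin 5) n] : OfNat Tower n := ⟨(h.ofNat : Fin 5)⟩

/-- The height of an element of the tower. -/
def rank : Tower → ℕ := ![0, 1, 1, 2, 2]

instance : PartialOrder Tower where
  le x y := x = y ∨ rank x < rank y
  lt x y := rank x < rank y
  le_refl x := Or.inl rfl
  le_trans x y z := by
    rintro (rfl | h) (rfl | h')
    exacts [Or.inl rfl, Or.inr h', Or.inr h, Or.inr (h.trans h')]
  le_antisymm x y := by
    rintro (rfl | h) (h' | h')
    exacts [rfl, rfl, h'.symm, (h.asymm h').elim]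
  lt_iff_le_not_ge x y := by
    constructor
    · intro h
      refine ⟨Or.inr h, ?_⟩
      rintro (rfl | h')
      exacts [h.ne rfl, h.asymm h']
    · rintro ⟨rfl | h, h'⟩
      exacts [(h' (Or.inl rfl)).elim, h]

instance : DecidableLE Tower := fun x y => inferInstanceAs (Decidable (x = y ∨ rank x < rank y))

instance : DecidableLT Tower := fun x y => inferInstanceAs (Decidable (rank x < rank y))

theorem covBy_iff (x y : Tower) : x ⋖ y ↔ rank y = rank x + 1 := by
  have key : ∀ x y : Tower, (x < y ∧ ∀ z, x < z → ¬z < y) ↔ rank y = rank x + 1 := by decide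
  exact key x y

/-- The chain cover of the tower consisting of `0 < i < 3` and `j < 4`. -/
def cover (i j : Tower) : Set (Set Tower) := {{0, i, 3}, {j, 4}}

theorem isChainCover_cover {i j : Tower} (h : i = 1 ∧ j = 2 ∨ i = 2 ∧ j = 1) :
    IsChainCover Tower (cover i j) := by
  refine ⟨?_, ?_, ?_⟩
  · rintro c (rfl | rfl) <;> refine ⟨?_, ?_⟩
    all_goals
      simp only [IsChain, Set.Pairwise, covBy_iff, Set.mem_insert_iff, Set.mem_singleton_iff]
      rcases h with ⟨rfl, rfl⟩ | ⟨rfl, rfl⟩ <;> decide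
  · suffices h : Disjoint ({0, i, 3} : Set Tower) {j, 4} from
      Set.pairwise_pair.2 fun _ => ⟨h, h.symm⟩
    rw [Set.disjoint_left]
    simp only [Set.mem_insert_iff, Set.mem_singleton_iff]
    rcases h with ⟨rfl, rfl⟩ | ⟨rfl, rfl⟩ <;> decide
  · simp only [cover, Set.mem_insert_iff, Set.mem_singleton_iff, exists_eq_or_imp,
      exists_eq_left]
    rcases h with ⟨rfl, rfl⟩ | ⟨rfl, rfl⟩ <;> decide

theorem sortedAlong_cover {i j : Tower} (h : i = 1 ∧ j = 2 ∨ i = 2 ∧ j = 1)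
    {lam mu nu : Tower → ℝ} (hmu : IsCSort Tower (cover i j) lam mu)
    (hnu : IsCSort Tower (cover j i) mu nu) : SortedAlong Tower (cover i j) nu := by
  obtain ⟨-, -, -, hmu⟩ := hmu
  obtain ⟨σ, hσ, hval, hnu⟩ := hnu
  simp only [cover, Set.mem_insert_iff, Set.mem_singleton_iff, forall_eq_or_imp,
    forall_eq] at hmu hσ hnu
  have hle : (0 : Tower) ≤ i ∧ i ≤ 3 ∧ j ≤ 4 ∧ 0 ≤ j ∧ j ≤ 3 ∧ i ≤ 4 := by
    rcases h with ⟨rfl, rfl⟩ | ⟨rfl, rfl⟩ <;> decide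
  have hne : (0 : Tower) ≠ j ∧ j ≠ 3 ∧ (0 : Tower) ≠ 3 ∧ i ≠ 4 := by
    rcases h with ⟨rfl, rfl⟩ | ⟨rfl, rfl⟩ <;> decide
  have hnle : ¬i ≤ 0 ∧ ¬(3 : Tower) ≤ i ∧ ¬4 ≤ j ∧ ¬(3 : Tower) ≤ 0 := by
    rcases h with ⟨rfl, rfl⟩ | ⟨rfl, rfl⟩ <;> decide
  obtain ⟨l₁, l₂, l₃, l₄, l₅, l₆⟩ := hle
  obtain ⟨n₁, n₂, n₃, n₄⟩ := hne
  have m₁ : mu 0 ≤ mu i := hmu.1.1.2.1 l₁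
  have m₂ : mu i ≤ mu 3 := hmu.1.2.1.2.2 l₂
  have m₃ : mu j ≤ mu 4 := hmu.2.1.2 l₃
  have k₁ : nu 0 ≤ nu j := hnu.1.1.2.1 l₄
  have k₂ : nu j ≤ nu 3 := hnu.1.2.1.2.2 l₅
  have k₃ : nu i ≤ nu 4 := hnu.2.1.2 l₆
  have inj₁ := σ.injective.ne n₁
  have inj₂ := σ.injective.ne n₂
  have inj₃ := σ.injective.ne n₃
  have inj₄ := σ.injective.ne n₄
  have main : nu 0 ≤ nu i ∧ nu i ≤ nu 3 ∧ nu j ≤ nu 4 := by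
    obtain ⟨⟨s₀, sj, s₃⟩, si, s₄⟩ := hσ
    simp only [hval] at k₁ k₂ k₃ ⊢
    rcases s₀ with s₀ | s₀ | s₀ <;> rcases sj with sj | sj | sj <;>
      rcases s₃ with s₃ | s₃ | s₃ <;> rcases si with si | si <;> rcases s₄ with s₄ | s₄ <;>
      simp only [s₀, sj, s₃, si, s₄, ne_eq, not_true_eq_false] at inj₁ inj₂ inj₃ inj₄ k₁ k₂ k₃ ⊢ <;>
      refine ⟨?_, ?_, ?_⟩ <;> linarith
  rintro c (rfl | rfl)
  · rintro x (rfl | rfl | rfl) y (rfl | rfl | rfl) hxy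
    exacts [le_rfl, main.1, main.1.trans main.2.1, (hnle.1 hxy).elim, le_rfl, main.2.1,
      (hnle.2.2.2 hxy).elim, (hnle.2.1 hxy).elim, le_rfl]
  · rintro x (rfl | rfl) y (rfl | rfl) hxy
    exacts [le_rfl, main.2.2, (hnle.2.2.1 hxy).elim, le_rfl]

theorem nmuVia_cover : NMUvia Tower (cover 1 2) (cover 2 1) := by
  refine ⟨isChainCover_cover (by decide), isChainCover_cover (by decide),
    fun _ _ _ => sortedAlong_cover (by decide), fun _ _ _ => sortedAlong_cover (by decide), ?_⟩
  simp only [covBy_iff, cover, Set.mem_insert_iff, Set.mem_singleton_iff, or_and_right, exists_or,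
    exists_eq_left]
  decide

theorem inN2p : InN2p Tower := by
  refine ⟨cover 1 2, cover 2 1, nmuVia_cover, ?_⟩
  rintro c₁ (rfl | rfl) c₂ (rfl | rfl)
  all_goals
    simp only [Set.subset_def, Set.mem_insert_iff, Set.mem_singleton_iff]
    decide

/-- In the tower, two transitive symmetric relations that only relate comparable elements and
that together contain all covering relations have a pair of distinct elements in common. -/
theorem exists_common_pair (R S : Tower → Tower → Prop)
    (hR : ∀ x y z, R x y → R x z → R y z) (hS : ∀ x y z, S x y → S x z → S y z)
    (hR' : ∀ x y, R x y → R y x) (hS' : ∀ x y, S x y → S y x)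
    (hRle : ∀ x y, R x y → x ≤ y ∨ y ≤ x) (hSle : ∀ x y, S x y → x ≤ y ∨ y ≤ x)
    (hcov : ∀ x y, x ⋖ y → R x y ∨ S x y) : ∃ x y, x ≠ y ∧ R x y ∧ S x y := by
  by_contra! hdisj
  have r₁₂ : ¬R 1 2 := fun h => absurd (hRle _ _ h) (by decide)
  have r₃₄ : ¬R 3 4 := fun h => absurd (hRle _ _ h) (by decide)
  have s₁₂ : ¬S 1 2 := fun h => absurd (hSle _ _ h) (by decide)
  have s₃₄ : ¬S 3 4 := fun h => absurd (hSle _ _ h) (by decide)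
  have e₀₁ := hcov 0 1 ((covBy_iff _ _).2 rfl)
  have e₀₂ := hcov 0 2 ((covBy_iff _ _).2 rfl)
  have e₁₃ := hcov 1 3 ((covBy_iff _ _).2 rfl)
  have e₁₄ := hcov 1 4 ((covBy_iff _ _).2 rfl)
  have e₂₃ := hcov 2 3 ((covBy_iff _ _).2 rfl)
  have e₂₄ := hcov 2 4 ((covBy_iff _ _).2 rfl)
  have d₀₃ := hdisj 0 3 (by decide)
  have d₀₄ := hdisj 0 4 (by decide)
  have hR₃ : ∀ x y z, R x y → R y z → R x z := fun x y z h h' => hR y x z (hR' x y h) h'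
  have hS₃ : ∀ x y z, S x y → S y z → S x z := fun x y z h h' => hS y x z (hS' x y h) h'
  have := hR 0 1 2
  have := hS 0 1 2
  have := hR 1 3 4
  have := hS 1 3 4
  have := hR₃ 1 3 2
  have := hS₃ 1 3 2
  have := hR₃ 1 4 2
  have := hS₃ 1 4 2
  have := hR' 2 3
  have := hS' 2 3
  have := hR' 2 4
  have := hS' 2 4
  have := hR₃ 0 1 3
  have := hS₃ 0 1 3
  have := hR₃ 0 2 3
  have := hS₃ 0 2 3
  have := hR₃ 0 1 4
  have := hS₃ 0 1 4
  have := hR₃ 0 2 4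
  have := hS₃ 0 2 4
  clear hR hS hR' hS' hRle hSle hcov hdisj hR₃ hS₃
  grind

theorem not_inN2pp : ¬InN2pp Tower := by
  rintro ⟨C₁, C₂, ⟨⟨hsat₁, hdisj₁, -⟩, ⟨hsat₂, hdisj₂, -⟩, -, -, hcov⟩, hinter⟩
  have htrans : ∀ C : Set (Set Tower), C.PairwiseDisjoint id → ∀ x y z,
      (∃ c ∈ C, x ∈ c ∧ y ∈ c) → (∃ c ∈ C, x ∈ c ∧ z ∈ c) → ∃ c ∈ C, y ∈ c ∧ z ∈ c := by
    rintro C hC x y z ⟨c, hc, hx, hy⟩ ⟨d, hd, hx', hz⟩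
    obtain rfl := hC.elim_set hc hd x hx hx'
    exact ⟨c, hc, hy, hz⟩
  have hsymm : ∀ C : Set (Set Tower), ∀ x y,
      (∃ c ∈ C, x ∈ c ∧ y ∈ c) → ∃ c ∈ C, y ∈ c ∧ x ∈ c :=
    fun C x y ⟨c, hc, hx, hy⟩ => ⟨c, hc, hy, hx⟩
  obtain ⟨x, y, hxy, ⟨c₁, hc₁, hx₁, hy₁⟩, c₂, hc₂, hx₂, hy₂⟩ := exists_common_pair
    (fun x y => ∃ c ∈ C₁, x ∈ c ∧ y ∈ c) (fun x y => ∃ c ∈ C₂, x ∈ c ∧ y ∈ c)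
    (htrans C₁ hdisj₁) (htrans C₂ hdisj₂) (hsymm C₁) (hsymm C₂)
    (fun x y ⟨c, hc, hx, hy⟩ => (hsat₁ c hc).1.total hx hy)
    (fun x y ⟨c, hc, hx, hy⟩ => (hsat₂ c hc).1.total hx hy)
    (fun x y h => by
      obtain ⟨c, hc | hc, hxy⟩ := hcov x y h
      exacts [Or.inl ⟨c, hc, hxy⟩, Or.inr ⟨c, hc, hxy⟩])
  exact hxy (Set.encard_le_one_iff.1 (hinter c₁ hc₁ c₂ hc₂) x y ⟨hx₁, hx₂⟩ ⟨hy₁, hy₂⟩)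

end Tower

/-- Neither of the classes `N₂′` and `N₂″` is contained in the other. -/
theorem n2p_n2pp_incomparable :
    (∃ (P : Type) (inst : PartialOrder P), Finite P ∧ @InN2pp P inst ∧ ¬@InN2p P inst) ∧
    (∃ (P : Type) (inst : PartialOrder P), Finite P ∧ @InN2p P inst ∧ ¬@InN2pp P inst) := by
  exact ⟨⟨Unit, inferInstance, inferInstance, inN2pp_unit, not_inN2p_unit⟩,
    ⟨Tower, inferInstance, inferInstance, Tower.inN2p, Tower.not_inN2pp⟩⟩
end
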